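/- arXiv:1011.4094 — 5 statements merged into one kernel-verified Lean document; each statement's English description precedes it below -/
import Mathlib

section
/- Let d ≥ 1 and let G(p) be a framework in ℝ^d with at least d + 2 vertices whose configuration p is in general position. If G(p) is globally rigid, then the graph G is (d+1)-connected; that is, for every set S of at most d vertices, the subgraph of G induced on the complement of S is connected. -/
noncomputable section

/-- A configuration of a framework: an assignment of points in `ℝ^d` to vertices. -/
abbrev Config (V : Type*) (d : ℕ) := V → EuclideanSpace ℝ (Fin d)

/-- A configuration is in general position if every `d + 1` of its points are
affinely independent. -/
def InGeneralPosition {V : Type*} (d : ℕ) (p : Config V d) : Prop :=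
  ∀ S : Finset V, S.card = d + 1 → AffineIndependent ℝ (fun i : S => p i.1)

/-- A framework `G(p)` in `ℝ^d` is globally rigid if every configuration in `ℝ^d`
equivalent to `p` (same lengths on edges) is congruent to `p` (same distances on all
pairs of vertices). -/
def GloballyRigid {V : Type*} {d : ℕ} (G : SimpleGraph V) (p : Config V d) : Prop :=
  ∀ q : Config V d,
    (∀ i j, G.Adj i j → dist (p i) (p j) = dist (q i) (q j)) →
    ∀ i j, dist (p i) (p j) = dist (q i) (q j)

/-- A globally rigid framework in general position in `ℝ^d`, with at least `d + 2`
vertices, is `(d+1)`-connected. -/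
theorem globallyRigid_isConnected {V : Type*} [Fintype V] {d : ℕ} (hd : 1 ≤ d)
    (G : SimpleGraph V) (p : Config V d)
    (hcard : d + 2 ≤ Fintype.card V)
    (hgen : InGeneralPosition d p)
    (hglob : GloballyRigid G p) :
    ∀ S : Finset V, S.card ≤ d → (G.induce ((↑S : Set V)ᶜ)).Connected := by
  classical
  intro S hS
  rw [SimpleGraph.connected_iff]
  refine ⟨?_, ?_⟩
  swap
  · obtain ⟨x, hx⟩ : ∃ x, x ∉ S := by
      by_contra! h
      have : S = Finset.univ := Finset.eq_univ_iff_forall.2 h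
      rw [this, Finset.card_univ] at hS
      omega
    exact ⟨⟨x, by simpa using hx⟩⟩
  rintro ⟨u, hu⟩ ⟨v, hv⟩
  by_contra hr
  have hu' : u ∉ S := by simpa using hu
  have hv' : v ∉ S := by simpa using hv
  have huv : u ≠ v := by
    rintro rfl
    exact hr (SimpleGraph.Reachable.refl _)
  -- extend `S` to `d` vertices avoiding `u` and `v`
  have hsub : S ⊆ Finset.univ \ {u, v} := by
    intro x hx
    simp only [Finset.mem_sdiff, Finset.mem_univ, true_and, Finset.mem_insert,
      Finset.mem_singleton]
    rintro (rfl | rfl)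
    · exact hu' hx
    · exact hv' hx
  have hc : d ≤ (Finset.univ \ {u, v} : Finset V).card := by
    rw [Finset.card_sdiff_of_subset (Finset.subset_univ _), Finset.card_univ,
      Finset.card_pair huv]
    omega
  obtain ⟨T, hST, hTuv, hT⟩ := Finset.exists_subsuperset_card_eq hsub hS hc
  have huT : u ∉ T := fun h => by simpa using hTuv h
  have hvT : v ∉ T := fun h => by simpa using hTuv h
  set H : AffineSubspace ℝ (EuclideanSpace ℝ (Fin d)) := affineSpan ℝ (p '' (T : Set V)) with hH
  have hmem : ∀ x ∈ T, p x ∈ H := fun x hx =>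
    subset_affineSpan ℝ _ (Set.mem_image_of_mem p (by simpa using hx))
  have hTne : T.Nonempty := Finset.card_pos.1 (by omega)
  obtain ⟨t, ht⟩ := hTne
  have : Nonempty H := ⟨⟨p t, hmem t ht⟩⟩
  -- `p u` is off the hyperplane
  have huH : p u ∉ H := by
    have hai := hgen (insert u T) (by rw [Finset.card_insert_of_notMem huT, hT])
    have := hai.notMem_affineSpan_sdiff ⟨u, Finset.mem_insert_self _ _⟩ Set.univ
    intro h
    apply this
    refine affineSpan_mono ℝ ?_ h
    rintro _ ⟨x, hx, rfl⟩
    have hx' : x ∈ T := by simpa using hx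
    refine ⟨⟨x, Finset.mem_insert_of_mem hx'⟩, ⟨trivial, ?_⟩, rfl⟩
    intro h
    have : x = u := congrArg Subtype.val h
    exact huT (this ▸ hx')
  have hspan : affineSpan ℝ (Set.range (fun i : (insert v T : Finset V) => p i.1)) = ⊤ := by
    have hai := hgen (insert v T) (by rw [Finset.card_insert_of_notMem hvT, hT])
    rw [hai.affineSpan_eq_top_iff_card_eq_finrank_add_one]
    rw [finrank_euclideanSpace_fin, Fintype.card_coe, Finset.card_insert_of_notMem hvT, hT]
  set A : V → Prop := fun i => ∃ h : i ∈ ((↑S : Set V)ᶜ),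
    (G.induce ((↑S : Set V)ᶜ)).Reachable ⟨u, hu⟩ ⟨i, h⟩ with hA
  set R := EuclideanGeometry.reflection H with hR
  have hfix : ∀ x ∈ T, R (p x) = p x := fun x hx =>
    (EuclideanGeometry.reflection_eq_self_iff _).2 (hmem x hx)
  have hcross : ∀ i j, G.Adj i j → A i → ¬ A j → j ∈ T := by
    rintro i j hij ⟨hi, hri⟩ hj
    by_contra hjT
    have hjS : j ∈ ((↑S : Set V)ᶜ) := by
      simpa using fun h => hjT (hST h)
    refine hj ⟨hjS, hri.trans (SimpleGraph.Adj.reachable ?_)⟩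
    simpa using hij
  have key := hglob (fun i => if A i then R (p i) else p i) (by
    intro i j hij
    by_cases hi : A i <;> by_cases hj : A j
    · simp only [hi, hj, if_true]
      exact (R.dist_map _ _).symm
    · simp only [hi, hj, if_true, if_false]
      have := hfix j (hcross i j hij hi hj)
      conv_rhs => rw [← this]
      exact (R.dist_map _ _).symm
    · simp only [hi, hj, if_true, if_false]
      have := hfix i (hcross j i hij.symm hj hi)
      conv_rhs => rw [← this]
      exact (R.dist_map _ _).symm
    · simp only [hi, hj, if_false])
  have hAu : A u := ⟨hu, SimpleGraph.Reachable.refl _⟩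
  have hAv : ¬ A v := fun ⟨_, h⟩ => hr h
  have huv2 := key u v
  simp only [hAu, hAv, if_true, if_false] at huv2
  have hle : affineSpan ℝ (Set.range (fun i : (insert v T : Finset V) => p i.1)) ≤
      AffineSubspace.perpBisector (p u) (R (p u)) := by
    rw [affineSpan_le]
    rintro _ ⟨⟨x, hx⟩, rfl⟩
    rw [SetLike.mem_coe, AffineSubspace.mem_perpBisector_iff_dist_eq]
    rcases Finset.mem_insert.1 hx with rfl | hx
    · simpa [dist_comm] using huv2
    · have := hfix x hx
      change dist (p x) (p u) = dist (p x) (R (p u))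
      conv_rhs => rw [← this]
      exact (R.dist_map _ _).symm
  rw [hspan] at hle
  have h1 : p u ∈ AffineSubspace.perpBisector (p u) (R (p u)) :=
    hle (AffineSubspace.mem_top ℝ _ _)
  rw [AffineSubspace.mem_perpBisector_iff_dist_eq, dist_self] at h1
  have h2 : R (p u) = p u := (dist_eq_zero.1 h1.symm).symm
  exact huH ((EuclideanGeometry.reflection_eq_self_iff _).1 h2)
end
end

section
/- Let G(p) be a generic framework in ℝ^d with at least d + 2 vertices. Then G(p) is universally rigid if and only if G(p) has a positive semidefinite stress matrix of nullity d + 1. -/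
open scoped BigOperators

noncomputable section

/-- A configuration is generic if its `|V| · d` coordinates are algebraically
independent over `ℚ`. -/
def Generic {V : Type*} {d : ℕ} (p : Config V d) : Prop :=
  AlgebraicIndependent ℚ (fun x : V × Fin d => p x.1 x.2)

/-- A framework `G(p)` in `ℝ^d` is universally rigid if for every `d' ≥ d`, every
configuration in `ℝ^{d'}` equivalent to `p` (same lengths on edges) is congruent to
`p` (same distances on all pairs of vertices). -/
def UniversallyRigid {V : Type*} {d : ℕ} (G : SimpleGraph V) (p : Config V d) : Prop :=
  ∀ d' : ℕ, d ≤ d' → ∀ q : Config V d',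
    (∀ i j, G.Adj i j → dist (p i) (p j) = dist (q i) (q j)) →
    ∀ i j, dist (p i) (p j) = dist (q i) (q j)

/-- A stress matrix of a framework `G(p)`: a symmetric matrix indexed by the vertices,
vanishing on non-adjacent off-diagonal pairs, whose rows sum to zero both with weights
`1` and with weights `p j`. -/
def IsStressMatrix {V : Type*} [Fintype V] {d : ℕ} (G : SimpleGraph V) (p : Config V d)
    (Ω : Matrix V V ℝ) : Prop :=
  Ω.IsSymm ∧ (∀ i j, i ≠ j → ¬ G.Adj i j → Ω i j = 0) ∧
    (∀ i, ∑ j, Ω i j = 0) ∧ (∀ i, ∑ j, Ω i j • p j = 0)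

theorem formallySmooth_charZero (K : Type*) (L : Type*) [Field K] [Field L] [CharZero K]
    [Algebra K L] : Algebra.FormallySmooth K L := by
  obtain ⟨s, hs⟩ := exists_isTranscendenceBasis K L
  have h := hs.isAlgebraic_field
  have : Algebra.IsSeparable (IntermediateField.adjoin K (Set.range ((↑) : s → L))) L := by
    have := h
    infer_instance
  exact .of_algebraicIndependent_of_isSeparable hs.1

open scoped IntermediateField.algebraAdjoinAdjoin in
theorem formallySmooth_adjoin {σ : Type*} (v : σ → ℝ) :
    Algebra.FormallySmooth (Algebra.adjoin ℚ (Set.range v)) ℝ := by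
  have h1 : Algebra.FormallySmooth (Algebra.adjoin ℚ (Set.range v))
      (IntermediateField.adjoin ℚ (Set.range v)) :=
    .of_isLocalization (nonZeroDivisors _)
  have h2 := formallySmooth_charZero (IntermediateField.adjoin ℚ (Set.range v)) ℝ
  exact .comp _ (IntermediateField.adjoin ℚ (Set.range v)) _

theorem exists_derivation_of_algebraicIndependent {σ : Type*} (v : σ → ℝ)
    (hv : AlgebraicIndependent ℚ v) (e : σ → ℝ) :
    ∃ D : ℝ → ℝ, (∀ a b, D (a + b) = D a + D b) ∧ (∀ a b, D (a * b) = a * D b + b * D a) ∧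
      ∀ i, D (v i) = e i := by
  classical
  have h3 := formallySmooth_adjoin v
  let φ : Algebra.adjoin ℚ (Set.range v) →ₐ[ℚ] TrivSqZeroExt ℝ ℝ :=
    (MvPolynomial.aeval (fun i => TrivSqZeroExt.inl (v i) + TrivSqZeroExt.inr (e i))).comp
      hv.aevalEquiv.symm.toAlgHom
  have hφX : ∀ i, φ ⟨v i, Algebra.subset_adjoin ⟨i, rfl⟩⟩ =
      TrivSqZeroExt.inl (v i) + TrivSqZeroExt.inr (e i) := by
    intro i
    have : hv.aevalEquiv.symm ⟨v i, Algebra.subset_adjoin ⟨i, rfl⟩⟩ = MvPolynomial.X i := by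
      rw [AlgEquiv.symm_apply_eq]
      ext
      simp
    simp [φ, this]
  have hfst : ∀ x : Algebra.adjoin ℚ (Set.range v), (φ x).fst = (x : ℝ) := by
    have : ((TrivSqZeroExt.fstHom ℚ ℝ ℝ).comp φ).comp hv.aevalEquiv.toAlgHom
        = (Algebra.adjoin ℚ (Set.range v)).val.comp hv.aevalEquiv.toAlgHom := by
      apply MvPolynomial.algHom_ext
      intro i
      have h : hv.aevalEquiv (MvPolynomial.X i) = ⟨v i, Algebra.subset_adjoin ⟨i, rfl⟩⟩ := by
        ext; simp
      simp [h, hφX]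
    intro x
    have h := DFunLike.congr_fun this (hv.aevalEquiv.symm x)
    simpa using h
  let alg : Algebra (Algebra.adjoin ℚ (Set.range v)) (TrivSqZeroExt ℝ ℝ) :=
    φ.toRingHom.toAlgebra
  let g : TrivSqZeroExt ℝ ℝ →ₐ[Algebra.adjoin ℚ (Set.range v)] ℝ :=
    { (TrivSqZeroExt.fstHom ℚ ℝ ℝ).toRingHom with
      commutes' := fun r => hfst r }
  have hg : Function.Surjective g := fun x => ⟨TrivSqZeroExt.inl x, rfl⟩
  have hg' : IsNilpotent (RingHom.ker (g : TrivSqZeroExt ℝ ℝ →+* ℝ)) := by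
    refine ⟨2, ?_⟩
    refine (pow_two (RingHom.ker (g : TrivSqZeroExt ℝ ℝ →+* ℝ))).trans ?_
    rw [Submodule.zero_eq_bot, eq_bot_iff, Ideal.mul_le]
    intro r hr s hs
    have hr' : r.fst = 0 := hr
    have hs' : s.fst = 0 := hs
    rw [Ideal.mem_bot]
    ext <;> simp [hr', hs']
  let f := Algebra.FormallySmooth.liftOfSurjective
    (AlgHom.id (Algebra.adjoin ℚ (Set.range v)) ℝ) g hg hg'
  have hf : ∀ x, (f x).fst = x := fun x =>
    Algebra.FormallySmooth.liftOfSurjective_apply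
      (AlgHom.id (Algebra.adjoin ℚ (Set.range v)) ℝ) g hg hg' x
  refine ⟨fun x => (f x).snd, ?_, ?_, ?_⟩
  · intro a b; simp
  · intro a b
    simp [hf]
    ring
  · intro i
    have h := f.commutes ⟨v i, Algebra.subset_adjoin ⟨i, rfl⟩⟩
    have h' : f (v i) = φ ⟨v i, Algebra.subset_adjoin ⟨i, rfl⟩⟩ := h
    simp [h', hφX]

/-- divided powers of a derivation -/
def dpow (D : ℝ → ℝ) (m : ℕ) (a : ℝ) : ℝ := (m.factorial : ℝ)⁻¹ * D^[m] a

theorem dpow_zero (D : ℝ → ℝ) (a : ℝ) : dpow D 0 a = a := by simp [dpow]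

theorem dpow_succ' (D : ℝ → ℝ) (m : ℕ) (a : ℝ) :
    dpow D m (D a) = (m + 1) * dpow D (m + 1) a := by
  simp only [dpow, Function.iterate_succ_apply, Nat.factorial_succ]
  push_cast
  have : (m.factorial : ℝ) ≠ 0 := by positivity
  field_simp

theorem iterate_add_of_additive (D : ℝ → ℝ) (hD : ∀ a b, D (a + b) = D a + D b) (m : ℕ) (a b : ℝ) :
    D^[m] (a + b) = D^[m] a + D^[m] b := by
  induction m generalizing a b with
  | zero => rfl
  | succ n ih => simp [hD, ih]

theorem dpow_add (D : ℝ → ℝ) (hD : ∀ a b, D (a + b) = D a + D b) (m : ℕ) (a b : ℝ) :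
    dpow D m (a + b) = dpow D m a + dpow D m b := by
  simp [dpow, iterate_add_of_additive D hD, mul_add]

def dpowHom (D : ℝ → ℝ) (hD : ∀ a b, D (a + b) = D a + D b) (m : ℕ) : ℝ →+ ℝ :=
  AddMonoidHom.mk' (dpow D m) (dpow_add D hD m)

theorem iterate_leibniz (D : ℝ → ℝ) (hD : ∀ a b, D (a + b) = D a + D b)
    (hD' : ∀ a b, D (a * b) = a * D b + b * D a) (n : ℕ) (a b : ℝ) :
    D^[n] (a * b) = ∑ ij ∈ Finset.HasAntidiagonal.antidiagonal n,
      n.choose ij.1 • (D^[ij.1] a * D^[ij.2] b) := by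
  induction n with
  | zero => simp
  | succ n ih =>
    rw [Finset.sum_antidiagonal_choose_succ_nsmul (fun i j => D^[i] a * D^[j] b) n]
    simp only [Function.iterate_succ_apply', ih]
    have hs : ∀ (s : Finset (ℕ × ℕ)) (f : ℕ × ℕ → ℝ), D (∑ x ∈ s, f x) = ∑ x ∈ s, D (f x) :=
      fun s f => map_sum (AddMonoidHom.mk' D hD) f s
    have hn : ∀ (k : ℕ) (x : ℝ), D (k • x) = k • D x :=
      fun k x => map_nsmul (AddMonoidHom.mk' D hD) k x
    rw [hs, ← Finset.sum_add_distrib]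
    refine Finset.sum_congr rfl fun ij hij => ?_
    rw [hn, hD']
    have : n.choose ij.1 = n.choose ij.2 := by
      rw [← Finset.HasAntidiagonal.mem_antidiagonal.1 hij]
      exact Nat.choose_symm_add
    rw [smul_add, this, mul_comm (D^[ij.2] b)]

theorem dpow_mul (D : ℝ → ℝ) (hD : ∀ a b, D (a + b) = D a + D b)
    (hD' : ∀ a b, D (a * b) = a * D b + b * D a) (n : ℕ) (a b : ℝ) :
    dpow D n (a * b) = ∑ ij ∈ Finset.HasAntidiagonal.antidiagonal n, dpow D ij.1 a * dpow D ij.2 b := by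
  simp only [dpow, iterate_leibniz D hD hD', Finset.mul_sum]
  refine Finset.sum_congr rfl fun ij hij => ?_
  have h := Finset.HasAntidiagonal.mem_antidiagonal.1 hij
  have h2 : ((ij.1 + ij.2).choose ij.1 : ℝ) * ij.1.factorial * ij.2.factorial =
    (ij.1 + ij.2).factorial := by
    rw [Nat.choose_symm_add]
    exact_mod_cast Nat.add_choose_mul_factorial_mul_factorial ij.1 ij.2
  rw [← h, nsmul_eq_mul, ← h2]
  have h1 : (ij.1.factorial : ℝ) ≠ 0 := by positivity
  have h3 : (ij.2.factorial : ℝ) ≠ 0 := by positivity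
  have h4 : ((ij.1 + ij.2).choose ij.1 : ℝ) ≠ 0 := by
    have := Nat.choose_pos (Nat.le_add_right ij.1 ij.2)
    positivity
  field_simp

/-- quadratic form of a square array -/
def quad {ι : Type*} [Fintype ι] (N : ι → ι → ℝ) (v : ι → ℝ) : ℝ :=
  ∑ k, ∑ l, N k l * (v k * v l)

section
variable {ι : Type*} [Fintype ι]

theorem quad_add (N M : ι → ι → ℝ) (v : ι → ℝ) : quad (N + M) v = quad N v + quad M v := by
  simp [quad, add_mul, Finset.sum_add_distrib]

theorem quad_smul (c : ℝ) (N : ι → ι → ℝ) (v : ι → ℝ) : quad (c • N) v = c * quad N v := by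
  simp [quad, Finset.mul_sum, mul_assoc]

theorem quad_smul_right (c : ℝ) (N : ι → ι → ℝ) (v : ι → ℝ) :
    quad N (c • v) = c ^ 2 * quad N v := by
  simp only [quad, Finset.mul_sum, Pi.smul_apply, smul_eq_mul]
  refine Finset.sum_congr rfl fun k _ => Finset.sum_congr rfl fun l _ => by ring

theorem quad_outer (u v : ι → ℝ) : quad (fun k l => u k * u l) v = (∑ k, u k * v k) ^ 2 := by
  rw [sq, Finset.sum_mul_sum]
  refine Finset.sum_congr rfl fun k _ => Finset.sum_congr rfl fun l _ => by ring

def quadLin (v : ι → ℝ) : (ι → ι → ℝ) →ₗ[ℝ] ℝ where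
  toFun N := quad N v
  map_add' N M := quad_add N M v
  map_smul' c N := quad_smul c N v

def idArr (ι : Type*) [DecidableEq ι] : ι → ι → ℝ := fun k l => if k = l then 1 else 0

theorem quad_idArr [DecidableEq ι] (v : ι → ℝ) : quad (idArr ι) v = ∑ k, v k ^ 2 := by
  simp [quad, idArr, sq]

theorem quad_idArr_pos [DecidableEq ι] (v : ι → ℝ) (hv : v ≠ 0) : 0 < quad (idArr ι) v := by
  rw [quad_idArr]
  obtain ⟨k, hk⟩ := Function.ne_iff.1 hv
  refine Finset.sum_pos' (fun _ _ => sq_nonneg _) ⟨k, Finset.mem_univ _, ?_⟩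
  have : v k ≠ 0 := hk
  positivity

theorem isOpen_pd (Q : Submodule ℝ (ι → ℝ)) :
    IsOpen {N : ι → ι → ℝ | ∀ v ∈ Q, v ≠ 0 → 0 < quad N v} := by
  have hcont : Continuous fun x : (ι → ι → ℝ) × (ι → ℝ) => quad x.1 x.2 := by
    unfold quad
    fun_prop
  have hK : IsCompact (Metric.sphere (0 : ι → ℝ) 1 ∩ Q) :=
    (isCompact_sphere 0 1).inter_right Q.closed_of_finiteDimensional
  rw [isOpen_iff_eventually]
  intro N hN
  have := hK.eventually_forall_of_forall_eventually (x₀ := N)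
    (P := fun N v => 0 < quad N v) (by
      intro v hv
      have hv0 : v ≠ 0 := by
        rintro rfl
        simpa using hv.1
      have h1 : 0 < quad N v := hN v hv.2 hv0
      exact hcont.continuousAt.eventually (lt_mem_nhds h1))
  filter_upwards [this] with M hM v hv hv0
  have hn : 0 < ‖v‖ := norm_pos_iff.2 hv0
  have := hM (‖v‖⁻¹ • v) ⟨by simp [norm_smul, hn.ne'], Q.smul_mem _ hv⟩
  rw [quad_smul_right] at this
  exact (pos_iff_pos_of_mul_pos this).1 (by positivity)

theorem convex_pd (Q : Submodule ℝ (ι → ℝ)) :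
    Convex ℝ {N : ι → ι → ℝ | ∀ v ∈ Q, v ≠ 0 → 0 < quad N v} := by
  intro N hN M hM a b ha hb hab v hv hv0
  rw [quad_add, quad_smul, quad_smul]
  have h1 := hN v hv hv0
  have h2 := hM v hv hv0
  rcases ha.eq_or_lt with rfl | ha
  · have : b = 1 := by linarith
    subst this; linarith
  · have := mul_pos ha h1
    have := mul_nonneg hb h2.le
    linarith

/-- Separation of a convex set from the open cone of arrays positive definite on `Q`. -/
theorem separation [DecidableEq ι] (Q : Submodule ℝ (ι → ℝ)) (T : Set (ι → ι → ℝ))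
    (hT : Convex ℝ T) (x : ι → ι → ℝ) (hx : x ∈ T) (hx0 : ∀ v ∈ Q, 0 ≤ quad x v)
    (hdisj : ∀ N ∈ T, ¬ ∀ v ∈ Q, v ≠ 0 → 0 < quad N v) :
    ∃ g : (ι → ι → ℝ) →ₗ[ℝ] ℝ, (∀ N, (∀ v ∈ Q, 0 ≤ quad N v) → 0 ≤ g N) ∧ 0 < g (idArr ι) ∧
      ∀ N ∈ T, g N ≤ 0 := by
  obtain ⟨f, u, hf1, hf2⟩ := geometric_hahn_banach_open (convex_pd Q) (isOpen_pd Q) hT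
    (Set.disjoint_left.2 fun N hN hN' => hdisj N hN' hN)
  have hI : ∀ v ∈ Q, v ≠ 0 → 0 < quad (idArr ι) v := fun v _ hv => quad_idArr_pos v hv
  -- cone facts
  have hcone : ∀ N, (∀ v ∈ Q, v ≠ 0 → 0 < quad N v) → ∀ t : ℝ, 0 < t → t * f N < u := by
    intro N hN t ht
    have := hf1 (t • N) (fun v hv hv0 => by
      rw [quad_smul]; exact mul_pos ht (hN v hv hv0))
    simpa using this
  have hpos : ∀ N, (∀ v ∈ Q, v ≠ 0 → 0 < quad N v) → f N ≤ 0 := by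
    intro N hN
    by_contra! h
    have h1 := hcone N hN ((|u| + 1) / f N) (by positivity)
    rw [div_mul_cancel₀ _ h.ne'] at h1
    have := le_abs_self u
    linarith
  have hpsd : ∀ N, (∀ v ∈ Q, 0 ≤ quad N v) → f N ≤ 0 := by
    intro N hN
    by_contra! h
    have h1 : ∀ t : ℝ, 0 < t → f N + t * f (idArr ι) ≤ 0 := by
      intro t ht
      have := hpos (N + t • idArr ι) (fun v hv hv0 => by
        rw [quad_add, quad_smul]
        have := hN v hv
        have := mul_pos ht (hI v hv hv0)
        linarith)
      simpa using this
    have h2 := hpos _ hI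
    have h3 := h1 (f N / (2 * (|f (idArr ι)| + 1))) (by positivity)
    have h4 : f N / (2 * (|f (idArr ι)| + 1)) * |f (idArr ι)| ≤ f N / 2 := by
      rw [div_mul_eq_mul_div, div_le_div_iff₀ (by positivity) (by positivity)]
      nlinarith [abs_nonneg (f (idArr ι))]
    rw [abs_of_nonpos h2] at *
    linarith
  have hu : 0 ≤ u := by
    by_contra! h
    have h0 := hpos _ hI
    have h1 := hcone _ hI (-u / (2 * (|f (idArr ι)| + 1))) (by
      apply div_pos (by linarith); positivity)
    have h4 : -u / (2 * (|f (idArr ι)| + 1)) * |f (idArr ι)| ≤ -u / 2 := by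
      rw [div_mul_eq_mul_div, div_le_div_iff₀ (by positivity) (by positivity)]
      nlinarith [abs_nonneg (f (idArr ι))]
    rw [abs_of_nonpos h0] at *
    linarith
  have hu0 : u = 0 := le_antisymm ((hf2 x hx).trans (hpsd x hx0)) hu
  refine ⟨-f.toLinearMap, fun N hN => ?_, ?_, fun N hN => ?_⟩
  · simpa using hpsd N hN
  · have := hf1 _ hI
    simpa [hu0] using this
  · have := hf2 N hN
    simpa [hu0] using this
end

section
variable {ι : Type*} [Fintype ι]

theorem quad_decomp (N : ι → ι → ℝ) (hN : ∀ v, 0 ≤ quad N v) :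
    ∃ (m : ℕ) (z : Fin m → ι → ℝ), ∀ v, quad N v = ∑ r, (∑ k, z r k * v k) ^ 2 := by
  classical
  have hquad : ∀ v, quad (fun k l => (N k l + N l k) / 2) v = quad N v := by
    intro v
    have h1 : quad (fun k l => N l k) v = quad N v := by
      unfold quad
      rw [Finset.sum_comm]
      refine Finset.sum_congr rfl fun k _ => Finset.sum_congr rfl fun l _ => by ring
    have h2 : (fun k l => (N k l + N l k) / 2) = (1 / 2 : ℝ) • (N + fun k l => N l k) := by
      ext k l
      simp only [Pi.smul_apply, Pi.add_apply, smul_eq_mul]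
      ring
    rw [h2, quad_smul, quad_add, h1]
    ring
  let M : Matrix ι ι ℝ := Matrix.of fun k l => (N k l + N l k) / 2
  have hM : M.PosSemidef := by
    refine Matrix.PosSemidef.of_dotProduct_mulVec_nonneg ?_ ?_
    · ext k l
      simp [M, add_comm]
    · intro v
      have : star v ⬝ᵥ M.mulVec v = quad (fun k l => (N k l + N l k) / 2) v := by
        simp only [dotProduct, Matrix.mulVec, quad, Finset.mul_sum, M, Matrix.of_apply,
          Pi.star_apply, star_trivial]
        refine Finset.sum_congr rfl fun k _ => Finset.sum_congr rfl fun l _ => by ring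
      rw [this, hquad]
      exact hN v
  obtain ⟨m, z, hz⟩ := Matrix.posSemidef_iff_eq_sum_vecMulVec.1 hM
  refine ⟨m, z, fun v => ?_⟩
  rw [← hquad]
  have h3 : (fun k l => (N k l + N l k) / 2) = ∑ r, fun k l => z r k * z r l := by
    ext k l
    have := congrFun (congrFun hz k) l
    simpa [M, Matrix.sum_apply, Matrix.vecMulVec_apply] using this
  rw [h3]
  have h4 : quad (∑ r, fun k l => z r k * z r l) v = ∑ r, quad (fun k l => z r k * z r l) v :=
    map_sum (quadLin v) (fun r => fun k l => z r k * z r l) Finset.univ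
  rw [h4]
  exact Finset.sum_congr rfl fun r _ => quad_outer _ _
end

/-- the energy form of a stress -/
def eform {V : Type*} [Fintype V] (w : V → V → ℝ) (u v : V → ℝ) : ℝ :=
  ∑ i, ∑ j, w i j * ((u i - u j) * (v i - v j))

theorem double_sum {V : Type*} [Fintype V] (c f : V → ℝ) (hc : ∑ i, c i = 0) :
    ∑ i, ∑ j, c i * c j * (f i - f j) ^ 2 = -2 * (∑ i, c i * f i) ^ 2 := by
  have h : ∀ i, ∑ j, c i * c j * (f i - f j) ^ 2 = 
      c i * f i ^ 2 * (∑ j, c j) - 2 * (c i * f i) * (∑ j, c j * f j)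
        + c i * ∑ j, c j * f j ^ 2 := by
    intro i
    simp only [Finset.mul_sum, ← Finset.sum_add_distrib, ← Finset.sum_sub_distrib]
    refine Finset.sum_congr rfl fun j _ => by ring
  simp only [h, hc]
  simp only [Finset.sum_add_distrib, Finset.sum_sub_distrib, ← Finset.sum_mul, hc,
    ← Finset.mul_sum]
  ring

theorem UniversallyRigid.fintype {V : Type*} {d : ℕ} {G : SimpleGraph V} {p : Config V d}
    (h : UniversallyRigid G p) {κ : Type*} [Fintype κ] (q : V → κ → ℝ)
    (hq : ∀ i j, G.Adj i j → ∑ a, (p i a - p j a) ^ 2 = ∑ k, (q i k - q j k) ^ 2) (i j : V) :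
    ∑ a, (p i a - p j a) ^ 2 = ∑ k, (q i k - q j k) ^ 2 := by
  classical
  let e := Fintype.equivFin (κ ⊕ Fin d)
  have hcard : d ≤ Fintype.card (κ ⊕ Fin d) := by simp
  let q' : Config V (Fintype.card (κ ⊕ Fin d)) := fun i =>
    WithLp.toLp 2 fun x => Sum.elim (q i) (fun _ => 0) (e.symm x)
  have hd : ∀ i j, dist (q' i) (q' j) = √(∑ k, (q i k - q j k) ^ 2) := by
    intro i j
    rw [EuclideanSpace.dist_eq]
    congr 1
    have : ∀ x, dist (q' i x) (q' j x) ^ 2 =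
      (Sum.elim (q i) (fun _ => 0) (e.symm x) - Sum.elim (q j) (fun _ => 0) (e.symm x)) ^ 2 := by
      intro x
      rw [Real.dist_eq, sq_abs]
    simp only [this]
    rw [Equiv.sum_comp e.symm
      (fun y => (Sum.elim (q i) (fun _ => 0) y - Sum.elim (q j) (fun _ => 0) y) ^ 2)]
    simp
  have hp : ∀ i j, dist (p i) (p j) = √(∑ a, (p i a - p j a) ^ 2) := by
    intro i j
    rw [EuclideanSpace.dist_eq]
    simp [Real.dist_eq, sq_abs]
  have := h _ hcard q' (fun i j hij => by rw [hd, hp, hq i j hij]) i j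
  rw [hd, hp] at this
  exact (Real.sqrt_inj (Finset.sum_nonneg fun _ _ => sq_nonneg _)
    (Finset.sum_nonneg fun _ _ => sq_nonneg _)).1 this

theorem facial {V : Type*} [Fintype V] {d : ℕ} {G : SimpleGraph V} {p : Config V d}
    (h : UniversallyRigid G p) {ι : Type*} [Fintype ι]
    (B : ι → V → ℝ) (C : Fin d → ι → ℝ) (hP : ∀ a i, p i a = ∑ k, C a k * B k i)
    (c : V → ℝ) (hc1 : ∑ i, c i = 0) (hcP : ∀ a, ∑ i, c i * p i a = 0)
    (hcB : ∃ k, ∑ i, c i * B k i ≠ 0) :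
    ∃ w : V → V → ℝ, (∀ i j, ¬ G.Adj i j → w i j = 0) ∧
      (∀ v : ι → ℝ, 0 ≤ eform w (fun i => ∑ k, v k * B k i) (fun i => ∑ k, v k * B k i)) ∧
      (∑ a, eform w (fun i => p i a) (fun i => p i a) = 0) ∧
      ∃ k, eform w (B k) (B k) ≠ 0 := by
  classical
  let b : V → V → ι → ℝ := fun i j k => B k i - B k j
  let T : Set (ι → ι → ℝ) :=
    {N | ∀ i j, G.Adj i j → quad N (b i j) = ∑ a, (p i a - p j a) ^ 2}
  let x : ι → ι → ℝ := ∑ a, fun k l => C a k * C a l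
  have hxq : ∀ v, quad x v = ∑ a, (∑ k, C a k * v k) ^ 2 := by
    intro v
    have h4 : quad x v = ∑ a, quad (fun k l => C a k * C a l) v :=
      map_sum (quadLin v) (fun a => fun k l => C a k * C a l) Finset.univ
    rw [h4]
    exact Finset.sum_congr rfl fun r _ => quad_outer _ _
  have hxT : x ∈ T := by
    intro i j _
    rw [hxq]
    refine Finset.sum_congr rfl fun a _ => ?_
    rw [hP, hP, ← Finset.sum_sub_distrib]
    simp [b, mul_sub]
  have hTconv : Convex ℝ T := by
    intro N hN M hM s t hs ht hst i j hij
    rw [quad_add, quad_smul, quad_smul, hN i j hij, hM i j hij, ← add_mul, hst, one_mul]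
  obtain ⟨g, hg1, hg2, hg3⟩ := separation ⊤ T hTconv x hxT
    (fun v _ => by rw [hxq]; exact Finset.sum_nonneg fun _ _ => sq_nonneg _) (by
    intro N hN hpd
    have hpsd : ∀ v, 0 ≤ quad N v := by
      intro v
      by_cases hv : v = 0
      · subst hv; simp [quad]
      · exact (hpd v trivial hv).le
    obtain ⟨m, z, hz⟩ := quad_decomp N hpsd
    let q : V → Fin m → ℝ := fun i r => ∑ k, z r k * B k i
    have hq : ∀ i j, quad N (b i j) = ∑ r, (q i r - q j r) ^ 2 := by
      intro i j
      rw [hz]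
      refine Finset.sum_congr rfl fun r _ => ?_
      simp only [q, b, mul_sub, Finset.sum_sub_distrib]
    have hcong := h.fintype q (fun i j hij => by rw [← hq, hN i j hij])
    have hsum : ∑ r, (∑ i, c i * q i r) ^ 2 = 0 := by
      have h1 : ∑ a, ∑ i, ∑ j, c i * c j * (p i a - p j a) ^ 2 =
          ∑ r, ∑ i, ∑ j, c i * c j * (q i r - q j r) ^ 2 := by
        rw [Finset.sum_comm]
        conv_rhs => rw [Finset.sum_comm]
        refine Finset.sum_congr rfl fun i _ => ?_
        rw [Finset.sum_comm]
        conv_rhs => rw [Finset.sum_comm]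
        refine Finset.sum_congr rfl fun j _ => ?_
        rw [← Finset.mul_sum, ← Finset.mul_sum, hcong]
      have h2 : ∀ a, ∑ i, ∑ j, c i * c j * (p i a - p j a) ^ 2 = 0 := by
        intro a
        rw [double_sum c (fun i => p i a) hc1, hcP]
        simp
      have h3 : ∀ r, ∑ i, ∑ j, c i * c j * (q i r - q j r) ^ 2 =
          -2 * (∑ i, c i * q i r) ^ 2 := fun r => double_sum c (fun i => q i r) hc1
      simp only [h2, h3, ← Finset.mul_sum] at h1
      simp at h1
      linarith
    have hv0 : (fun k => ∑ i, c i * B k i) ≠ 0 := by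
      obtain ⟨k, hk⟩ := hcB
      exact fun h0 => hk (congrFun h0 k)
    have := hpd _ trivial hv0
    rw [hz] at this
    have h5 : ∀ r, ∑ k, z r k * ∑ i, c i * B k i = ∑ i, c i * q i r := by
      intro r
      simp only [q, Finset.mul_sum]
      rw [Finset.sum_comm]
      refine Finset.sum_congr rfl fun k _ => Finset.sum_congr rfl fun l _ => by ring
    simp only [h5, hsum] at this
    exact lt_irrefl _ this)
  have hgx : g x = 0 := le_antisymm (hg3 x hxT) (hg1 x fun v _ => by
    rw [hxq]; exact Finset.sum_nonneg fun _ _ => sq_nonneg _)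
  let L : V × V → (ι → ι → ℝ) →ₗ[ℝ] ℝ := fun e =>
    if G.Adj e.1 e.2 then quadLin (b e.1 e.2) else 0
  have hker : ⨅ e, LinearMap.ker (L e) ≤ LinearMap.ker g := by
    intro N hN
    rw [Submodule.mem_iInf] at hN
    have hN' : ∀ i j, G.Adj i j → quad N (b i j) = 0 := by
      intro i j hij
      have := hN (i, j)
      simp only [L, hij, if_true, LinearMap.mem_ker] at this
      exact this
    have hmem : ∀ t : ℝ, x + t • N ∈ T := by
      intro t i j hij
      rw [quad_add, quad_smul, hN' i j hij, hxT i j hij]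
      ring
    have h1 := hg3 _ (hmem 1)
    have h2 := hg3 _ (hmem (-1))
    simp only [map_add, map_smul, hgx, smul_eq_mul] at h1 h2
    rw [LinearMap.mem_ker]
    linarith
  have hspan := mem_span_of_iInf_ker_le_ker hker
  rw [Submodule.mem_span_range_iff_exists_fun] at hspan
  obtain ⟨ω, hω⟩ := hspan
  let w : V → V → ℝ := fun i j => if G.Adj i j then ω (i, j) else 0
  have hgw : ∀ N, g N = ∑ i, ∑ j, w i j * quad N (b i j) := by
    intro N
    rw [← hω, ← Fintype.sum_prod_type']
    simp only [LinearMap.sum_apply, LinearMap.smul_apply, smul_eq_mul]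
    refine Finset.sum_congr rfl fun e _ => ?_
    simp only [L, w]
    split_ifs
    · rfl
    · simp
  have hout : ∀ v : ι → ℝ, g (fun k l => v k * v l) =
      eform w (fun i => ∑ k, v k * B k i) (fun i => ∑ k, v k * B k i) := by
    intro v
    rw [hgw]
    unfold eform
    refine Finset.sum_congr rfl fun i _ => Finset.sum_congr rfl fun j _ => ?_
    rw [quad_outer, ← Finset.sum_sub_distrib, sq]
    simp only [b, mul_sub]
  refine ⟨w, fun i j hij => by simp [w, hij], ?_, ?_, ?_⟩
  · intro v
    rw [← hout]
    exact hg1 _ fun u _ => by rw [quad_outer]; positivity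
  · have : ∀ a, (fun i => p i a) = fun i => ∑ k, C a k * B k i := fun a => funext (hP a)
    simp only [this, ← hout]
    rw [← map_sum]
    exact hgx
  · by_contra! hcon
    have hI : idArr ι = ∑ k, fun l m => (Pi.single k 1 : ι → ℝ) l * (Pi.single k 1 : ι → ℝ) m := by
      ext l m
      simp [idArr, Finset.sum_apply, Pi.single_apply]
    rw [hI, map_sum] at hg2
    have : ∀ k, g (fun l m => (Pi.single k 1 : ι → ℝ) l * (Pi.single k 1 : ι → ℝ) m) = 0 := by
      intro k
      rw [hout, ← hcon k]
      simp [Pi.single_apply]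
    simp [this] at hg2

/-- the Laplacian-type array of a weight -/
def lap {V : Type*} [Fintype V] [DecidableEq V] (w : V → V → ℝ) : V → V → ℝ :=
  fun i j => (if i = j then ∑ k, (w i k + w k i) else 0) - (w i j + w j i)

section
variable {V : Type*} [Fintype V] [DecidableEq V]

theorem lap_symm (w : V → V → ℝ) (i j : V) : lap w i j = lap w j i := by
  unfold lap
  by_cases h : i = j
  · subst h; rfl
  · rw [if_neg h, if_neg (Ne.symm h), add_comm (w i j)]

theorem lap_rowsum (w : V → V → ℝ) (i : V) : ∑ j, lap w i j = 0 := by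
  simp [lap]

theorem lap_mul (w : V → V → ℝ) (u v : V → ℝ) :
    ∑ i, ∑ j, lap w i j * (u i * v j) = eform w u v := by
  unfold lap eform
  have h1 : ∀ i, ∑ j, ((if i = j then ∑ k, (w i k + w k i) else 0) - (w i j + w j i)) * (u i * v j)
      = (∑ j, (w i j * (u i * v i) + w j i * (u i * v i))) - 
        ∑ j, (w i j * (u i * v j) + w j i * (u i * v j)) := by
    intro i
    simp only [sub_mul, Finset.sum_sub_distrib, ite_mul, zero_mul, Finset.sum_ite_eq,
      Finset.mem_univ, if_true, Finset.sum_mul, add_mul]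
  rw [Finset.sum_congr rfl fun i _ => h1 i]
  simp only [Finset.sum_sub_distrib, Finset.sum_add_distrib]
  rw [Finset.sum_comm (f := fun i j => w j i * (u i * v i)),
    Finset.sum_comm (f := fun i j => w j i * (u i * v j))]
  simp only [← Finset.sum_sub_distrib, ← Finset.sum_add_distrib]
  refine Finset.sum_congr rfl fun i _ => Finset.sum_congr rfl fun j _ => by ring

theorem lap_eq_sum (w : V → V → ℝ) :
    lap w = ∑ i, ∑ j, w i j • fun k l => ((Pi.single i 1 : V → ℝ) k - (Pi.single j 1 : V → ℝ) k) *
      ((Pi.single i 1 : V → ℝ) l - (Pi.single j 1 : V → ℝ) l) := by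
  ext k l
  have h := lap_mul w (Pi.single k 1) (Pi.single l 1)
  have h2 : ∑ i, ∑ j, lap w i j * ((Pi.single k 1 : V → ℝ) i * (Pi.single l 1 : V → ℝ) j) =
      lap w k l := by
    simp [Pi.single_apply]
  rw [← h2, h]
  unfold eform
  simp only [Finset.sum_apply, Pi.smul_apply, smul_eq_mul]
  refine Finset.sum_congr rfl fun i _ => Finset.sum_congr rfl fun j _ => ?_
  simp only [Pi.single_apply, eq_comm]
end

section
variable {V : Type*} [Fintype V] {d : ℕ}

/-- general position -/
theorem general_position {p : Config V d} (hgen : Generic p) (s : Fin (d + 1) → V)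
    (hs : Function.Injective s) (c0 : ℝ) (c : Fin d → ℝ)
    (h : ∀ k, c0 + ∑ a, c a * p (s k) a = 0) : c0 = 0 ∧ c = 0 := by
  classical
  let M : Matrix (Fin (d + 1)) (Fin (d + 1)) (MvPolynomial (V × Fin d) ℚ) :=
    Matrix.of fun k a => Fin.cases 1 (fun a => MvPolynomial.X (s k, a)) a
  let y : V → ℚ := fun i => ((Fintype.equivFin V i : ℕ) : ℚ)
  have hy : Function.Injective y := by
    intro i j hij
    have : (Fintype.equivFin V i : ℕ) = Fintype.equivFin V j := by
      simpa [y] using hij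
    exact (Fintype.equivFin V).injective (Fin.ext this)
  have hdet : M.det ≠ 0 := by
    intro h0
    let φ : MvPolynomial (V × Fin d) ℚ →+* ℚ :=
      (MvPolynomial.eval fun x : V × Fin d => y x.1 ^ ((x.2 : ℕ) + 1))
    have h1 := φ.map_det M
    rw [h0, map_zero] at h1
    have h2 : φ.mapMatrix M = Matrix.vandermonde (fun k => y (s k)) := by
      ext k a
      refine Fin.cases ?_ (fun a => ?_) a <;> simp [M, φ, Matrix.vandermonde]
    rw [h2] at h1
    exact Matrix.det_vandermonde_ne_zero_iff.2 (hy.comp hs) h1.symm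
  let ψ : MvPolynomial (V × Fin d) ℚ →ₐ[ℚ] ℝ :=
    MvPolynomial.aeval fun x : V × Fin d => p x.1 x.2
  have hψ : Function.Injective ψ := hgen
  have hdet2 : (ψ.toRingHom.mapMatrix M).det ≠ 0 := by
    rw [← RingHom.map_det]
    intro h0
    exact hdet (hψ (by simpa using h0))
  have hv := Matrix.eq_zero_of_mulVec_eq_zero hdet2 (v := Fin.cons c0 c) (by
    ext k
    simp only [Matrix.mulVec, dotProduct, Fin.sum_univ_succ]
    rw [Pi.zero_apply, ← h k]
    simp [M, ψ, mul_comm])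
  constructor
  · simpa using congrFun hv 0
  · ext a
    simpa using congrFun hv a.succ

theorem affine_vanish {p : Config V d} (hgen : Generic p) (S : Finset V) (hS : d + 1 ≤ S.card)
    (c0 : ℝ) (c : Fin d → ℝ) (h : ∀ k ∈ S, c0 + ∑ a, c a * p k a = 0) : c0 = 0 ∧ c = 0 := by
  obtain ⟨S', hS', hc⟩ := Finset.exists_subset_card_eq hS
  let e := S'.equivFinOfCardEq hc
  exact general_position hgen (fun k => (e.symm k : V))
    (fun a b hab => e.symm.injective (Subtype.ext hab)) c0 c
    (fun k => h _ (hS' (e.symm k).2))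
end

section
variable {V : Type*} [Fintype V] {d : ℕ}

/-- affine functions of the configuration -/
def affMap (p : Config V d) : (ℝ × (Fin d → ℝ)) →ₗ[ℝ] (V → ℝ) where
  toFun x i := x.1 + ∑ a, x.2 a * p i a
  map_add' x y := by
    ext i
    simp only [Prod.fst_add, Prod.snd_add, Pi.add_apply, add_mul, Finset.sum_add_distrib]
    ring
  map_smul' r x := by
    ext i
    simp [Finset.mul_sum, mul_add, mul_assoc]

theorem affMap_apply (p : Config V d) (x : ℝ × (Fin d → ℝ)) (i : V) :
    affMap p x i = x.1 + ∑ a, x.2 a * p i a := rfl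

theorem affMap_injective {p : Config V d} (hgen : Generic p) (hcard : d + 1 ≤ Fintype.card V) :
    Function.Injective (affMap p) := by
  rw [injective_iff_map_eq_zero]
  intro x hx
  have := affine_vanish hgen Finset.univ hcard x.1 x.2 (fun k _ => congrFun hx k)
  exact Prod.ext this.1 this.2

theorem finrank_range_affMap {p : Config V d} (hgen : Generic p)
    (hcard : d + 1 ≤ Fintype.card V) :
    Module.finrank ℝ (LinearMap.range (affMap p)) = d + 1 := by
  rw [LinearMap.finrank_range_of_inj (affMap_injective hgen hcard)]
  simp [add_comm]

/-- affine dependencies of the configuration -/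
def depSub (p : Config V d) : Submodule ℝ (V → ℝ) where
  carrier := {u | ∑ i, u i = 0 ∧ ∀ a, ∑ i, u i * p i a = 0}
  add_mem' := by
    rintro u v ⟨h1, h2⟩ ⟨h3, h4⟩
    refine ⟨by simp [Finset.sum_add_distrib, h1, h3], fun a => ?_⟩
    simp [add_mul, Finset.sum_add_distrib, h2, h4]
  zero_mem' := by simp
  smul_mem' := by
    rintro r u ⟨h1, h2⟩
    refine ⟨by simp [← Finset.mul_sum, h1], fun a => ?_⟩
    simp [mul_assoc, ← Finset.mul_sum, h2]

theorem exists_decomp (p : Config V d) (u : V → ℝ) :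
    ∃ x, ∃ v ∈ depSub p, u = affMap p x + v := by
  let e := (WithLp.linearEquiv 2 ℝ (V → ℝ)).symm
  let K : Submodule ℝ (EuclideanSpace ℝ V) := LinearMap.range (e.toLinearMap ∘ₗ affMap p)
  obtain ⟨y, hy, z, hz, hyz⟩ := K.exists_add_mem_mem_orthogonal (WithLp.toLp 2 u)
  obtain ⟨x, rfl⟩ := hy
  have hz' : ∀ x, ∑ i, z i * affMap p x i = 0 := by
    intro x
    have := (Submodule.mem_orthogonal K z).1 hz _ (LinearMap.mem_range_self _ x)
    simpa [PiLp.inner_apply, e] using this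
  refine ⟨x, fun i => z i, ⟨?_, fun a => ?_⟩, ?_⟩
  · simpa [affMap_apply] using hz' (1, 0)
  · classical
    simpa [affMap_apply, Pi.single_apply] using hz' (0, Pi.single a 1)
  · ext i
    have := congrArg (fun f : EuclideanSpace ℝ V => f i) hyz
    simpa [e] using this

theorem affMap_dep {p : Config V d} {v : V → ℝ} (hv : v ∈ depSub p) (x : ℝ × (Fin d → ℝ)) :
    ∑ i, v i * affMap p x i = 0 := by
  simp only [affMap_apply, mul_add, Finset.sum_add_distrib, Finset.mul_sum, ← Finset.sum_mul, hv.1]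
  rw [Finset.sum_comm, zero_mul, zero_add]
  refine Finset.sum_eq_zero fun a _ => ?_
  have : ∀ i, v i * (x.2 a * p i a) = x.2 a * (v i * p i a) := fun i => by ring
  simp only [this, ← Finset.mul_sum, hv.2 a, mul_zero]

theorem affMap_mulVec {p : Config V d} {M : Matrix V V ℝ} (h1 : ∀ i, ∑ j, M i j = 0)
    (h2 : ∀ i a, ∑ j, M i j * p j a = 0) (x : ℝ × (Fin d → ℝ)) : M.mulVec (affMap p x) = 0 := by
  ext i
  exact affMap_dep (v := M i) ⟨h1 i, h2 i⟩ x

theorem nullity_lemma {p : Config V d} (hgen : Generic p) (hcard : d + 1 ≤ Fintype.card V)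
    (M : Matrix V V ℝ) (hsymm : M.IsSymm) (h1 : ∀ i, ∑ j, M i j = 0)
    (h2 : ∀ i a, ∑ j, M i j * p j a = 0)
    (hpos : ∀ v ∈ depSub p, v ≠ 0 → 0 < quad M v) :
    M.PosSemidef ∧ Module.finrank ℝ (LinearMap.ker M.mulVecLin) = d + 1 := by
  have hq : ∀ v, v ⬝ᵥ M.mulVec v = quad M v := by
    intro v
    simp only [dotProduct, Matrix.mulVec, quad, Finset.mul_sum]
    refine Finset.sum_congr rfl fun k _ => Finset.sum_congr rfl fun l _ => by ring
  have hMA := affMap_mulVec h1 h2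
  constructor
  · refine Matrix.PosSemidef.of_dotProduct_mulVec_nonneg ?_ ?_
    · ext i j
      simpa using hsymm.apply i j
    · intro u
      obtain ⟨x, v, hv, rfl⟩ := exists_decomp p u
      have : star (affMap p x + v) ⬝ᵥ M.mulVec (affMap p x + v) = quad M v := by
        rw [star_trivial, Matrix.mulVec_add, hMA, zero_add, add_dotProduct, ← hq,
          Matrix.dotProduct_mulVec, ← Matrix.mulVec_transpose, hsymm.eq, hMA]
        simp
      rw [this]
      by_cases h0 : v = 0
      · subst h0; simp [quad]
      · exact (hpos v hv h0).le
  · have : LinearMap.ker M.mulVecLin = LinearMap.range (affMap p) := by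
      apply le_antisymm
      · intro u hu
        obtain ⟨x, v, hv, rfl⟩ := exists_decomp p u
        rw [LinearMap.mem_ker, Matrix.mulVecLin_apply, Matrix.mulVec_add, hMA, zero_add] at hu
        have h0 : v = 0 := by
          by_contra h0
          have := hpos v hv h0
          rw [← hq, hu] at this
          simp at this
        subst h0
        exact ⟨x, by simp⟩
      · rintro _ ⟨x, rfl⟩
        exact hMA x
    rw [this, finrank_range_affMap hgen hcard]

theorem stress_coord {p : Config V d} {Ω : Matrix V V ℝ}
    : (∀ i, ∑ j, Ω i j • p j = 0) ↔ ∀ i a, ∑ j, Ω i j * p j a = 0 := by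
  constructor
  · intro h i a
    have := congrArg (fun f : EuclideanSpace ℝ (Fin d) => f a) (h i)
    simpa using this
  · intro h i
    ext a
    simpa using h i a
end

theorem outer_lin {ι : Type*} [Fintype ι] [DecidableEq ι] (g : (ι → ι → ℝ) →ₗ[ℝ] ℝ)
    (v : ι → ℝ) : g (fun k l => v k * v l) =
      quad (fun k l => g (Pi.single k (Pi.single l 1))) v := by
  have : (fun k l => v k * v l) =
      ∑ k, ∑ l, (v k * v l) • (Pi.single k (Pi.single l 1) : ι → ι → ℝ) := by
    ext i j
    simp only [Finset.sum_apply, Pi.smul_apply, smul_eq_mul]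
    rw [Finset.sum_eq_single i, Finset.sum_eq_single j]
    · simp
    · intro l _ hl; simp [Ne.symm hl]
    · simp
    · intro k _ hk; simp [Ne.symm hk]
    · simp
  rw [this]
  simp only [map_sum, map_smul, smul_eq_mul, quad]
  refine Finset.sum_congr rfl fun k _ => Finset.sum_congr rfl fun l _ => by ring

theorem stiemke {V : Type*} [Fintype V] [DecidableEq V] {d : ℕ} {G : SimpleGraph V}
    {p : Config V d} (hgen : Generic p) (hcard : d + 1 ≤ Fintype.card V)
    (hno : ¬ ∃ Ω : Matrix V V ℝ, IsStressMatrix G p Ω ∧ Ω.PosSemidef ∧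
        Module.finrank ℝ (LinearMap.ker Ω.mulVecLin) = d + 1) :
    ∃ (m : ℕ) (k : Fin m → V → ℝ) (E : Fin d → V → ℝ), (∀ b, k b ∈ depSub p) ∧ (∃ b, k b ≠ 0) ∧
      ∀ i j, G.Adj i j → ∑ b, (k b i - k b j) ^ 2 +
        2 * ∑ a, (p i a - p j a) * (E a i - E a j) = 0 := by
  classical
  let T : Submodule ℝ (V → V → ℝ) :=
    { carrier := {N | (∀ i j, N i j = N j i) ∧ (∀ i j, i ≠ j → ¬ G.Adj i j → N i j = 0) ∧
        (∀ i, ∑ j, N i j = 0) ∧ ∀ i a, ∑ j, N i j * p j a = 0}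
      add_mem' := by
        rintro N M ⟨h1, h2, h3, h4⟩ ⟨k1, k2, k3, k4⟩
        refine ⟨fun i j => ?_, fun i j hij hG => ?_, fun i => ?_, fun i a => ?_⟩
        · simp [h1 i j, k1 i j]
        · simp [h2 i j hij hG, k2 i j hij hG]
        · simp [Finset.sum_add_distrib, h3 i, k3 i]
        · simp [Finset.sum_add_distrib, add_mul, h4 i, k4 i]
      zero_mem' := by simp
      smul_mem' := by
        rintro r N ⟨h1, h2, h3, h4⟩
        refine ⟨fun i j => ?_, fun i j hij hG => ?_, fun i => ?_, fun i a => ?_⟩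
        · simp [h1 i j]
        · simp [h2 i j hij hG]
        · simp [← Finset.mul_sum, h3 i]
        · simp [← Finset.mul_sum, mul_assoc, h4 i] }
  obtain ⟨g, hg1, hg2, hg3⟩ := separation (depSub p) (T : Set (V → V → ℝ)) T.convex 0 T.zero_mem
    (fun v _ => by simp [quad]) (by
      rintro N ⟨h1, h2, h3, h4⟩ hpd
      apply hno
      have := nullity_lemma hgen hcard (Matrix.of N) (Matrix.IsSymm.ext fun i j => h1 j i) h3 h4 hpd
      exact ⟨Matrix.of N, ⟨Matrix.IsSymm.ext fun i j => h1 j i, h2, h3, stress_coord.2 h4⟩, this⟩)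
  have hgT : ∀ N ∈ T, g N = 0 := by
    intro N hN
    have h1 := hg3 N hN
    have h2 := hg3 (-N) (T.neg_mem hN)
    rw [map_neg] at h2
    linarith
  have hout := outer_lin g
  obtain ⟨m, k, hk⟩ := quad_decomp (fun k l => g (Pi.single k (Pi.single l 1))) (fun v => by
    rw [← hout]
    exact hg1 _ fun u _ => by rw [quad_outer]; positivity)
  have hgk : ∀ v : V → ℝ, g (fun k l => v k * v l) = ∑ b, (∑ i, k b i * v i) ^ 2 := fun v => by
    rw [hout, hk]
  have hperp : ∀ (c : V → ℝ), (∀ v ∈ depSub p, ∑ i, c i * v i = 0) → ∀ b, ∑ i, k b i * c i = 0 := by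
    intro c hc b
    have h0 : ∑ b, (∑ i, k b i * c i) ^ 2 = 0 := by
      rw [← hgk]
      apply le_antisymm
      · have := hg1 (-(fun k l => c k * c l)) (fun v hv => by
          have : quad (-(fun k l => c k * c l)) v = -1 * quad (fun k l => c k * c l) v := by
            rw [← quad_smul]; simp
          rw [this, quad_outer, hc v hv]
          simp)
        rw [map_neg] at this
        linarith
      · exact hg1 _ fun u _ => by rw [quad_outer]; positivity
    rw [Finset.sum_eq_zero_iff_of_nonneg fun _ _ => sq_nonneg _] at h0
    exact pow_eq_zero_iff two_ne_zero |>.1 (h0 b (Finset.mem_univ _))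
  have hkdep : ∀ b, k b ∈ depSub p := by
    intro b
    refine ⟨?_, fun a => hperp (fun i => p i a) (fun v hv => ?_) b⟩
    · simpa using hperp (fun _ => 1) (fun v hv => by simpa using hv.1) b
    · rw [← hv.2 a]
      exact Finset.sum_congr rfl fun i _ => mul_comm _ _
  have hkne : ∃ b, k b ≠ 0 := by
    by_contra! hcon
    have hI : idArr V = ∑ k, fun l m => (Pi.single k 1 : V → ℝ) l * (Pi.single k 1 : V → ℝ) m := by
      ext l m
      simp [idArr, Finset.sum_apply, Pi.single_apply]
    rw [hI, map_sum] at hg2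
    simp [hgk, hcon] at hg2
  -- solve for the first-order flex
  let Φ : (Fin d → V → ℝ) →ₗ[ℝ] (V × V → ℝ) :=
    { toFun := fun E e => if G.Adj e.1 e.2 then
        ∑ a, (p e.1 a - p e.2 a) * (E a e.1 - E a e.2) else 0
      map_add' := by
        intro E F
        ext e
        simp only [Pi.add_apply]
        split_ifs
        · rw [← Finset.sum_add_distrib]
          exact Finset.sum_congr rfl fun a _ => by ring
        · simp
      map_smul' := by
        intro r E
        ext e
        simp only [Pi.smul_apply, smul_eq_mul, RingHom.id_apply]
        split_ifs
        · rw [Finset.mul_sum]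
          exact Finset.sum_congr rfl fun a _ => by ring
        · simp }
  let β : V × V → ℝ := fun e => if G.Adj e.1 e.2 then ∑ b, (k b e.1 - k b e.2) ^ 2 else 0
  have hβ : β ∈ LinearMap.range Φ := by
    by_contra hcon
    obtain ⟨ω, hω1, hω2⟩ := Submodule.exists_le_ker_of_notMem hcon
    let w : V → V → ℝ := fun i j => if G.Adj i j then ω (Pi.single (i, j) 1) else 0
    have hωsum : ∀ f : V × V → ℝ, ω f = ∑ i, ∑ j, f (i, j) * ω (Pi.single (i, j) 1) := by
      intro f
      rw [← Fintype.sum_prod_type' (f := fun i j => f (i, j) * ω (Pi.single (i, j) 1))]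
      conv_lhs => rw [pi_eq_sum_univ' f]
      rw [map_sum]
      refine Finset.sum_congr rfl fun e _ => ?_
      rw [map_smul, smul_eq_mul]
    have hstress : ∀ a v, eform w (fun i => p i a) v = 0 := by
      intro a v
      have h1 : ω (Φ (Pi.single a v)) = 0 := hω2 (LinearMap.mem_range_self Φ _)
      rw [hωsum] at h1
      rw [← h1]
      unfold eform
      refine Finset.sum_congr rfl fun i _ => Finset.sum_congr rfl fun j _ => ?_
      simp only [w, Φ, LinearMap.coe_mk, AddHom.coe_mk]
      split_ifs
      · rw [Finset.sum_eq_single a]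
        · simp; ring
        · intro a' _ ha'; simp [ha']
        · simp
      · simp
    have hlapT : lap w ∈ T := by
      refine ⟨lap_symm w, fun i j hij hG => ?_, lap_rowsum w, fun i a => ?_⟩
      · have hG' : ¬ G.Adj j i := fun h => hG h.symm
        simp [lap, hij, w, hG, hG']
      · have h1 := hstress a (Pi.single i 1)
        rw [← lap_mul] at h1
        rw [← h1]
        refine Finset.sum_congr rfl fun j _ => ?_
        rw [Finset.sum_eq_single i]
        · simp [lap_symm w i j]
        · intro b _ hb
          simp [hb]
        · simp
    have h2 := hgT _ hlapT
    rw [lap_eq_sum] at h2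
    simp only [map_sum, map_smul, smul_eq_mul] at h2
    apply hω1
    rw [hωsum, ← h2]
    refine Finset.sum_congr rfl fun i _ => Finset.sum_congr rfl fun j _ => ?_
    rw [hgk (fun k => (Pi.single i 1 : V → ℝ) k - (Pi.single j 1 : V → ℝ) k)]
    simp only [w, β]
    split_ifs
    · rw [mul_comm]
      congr 1
      refine Finset.sum_congr rfl fun b _ => ?_
      simp [mul_sub, Finset.sum_sub_distrib, Pi.single_apply]
    · simp
  obtain ⟨E, hE⟩ := hβ
  refine ⟨m, k, (-1 / 2 : ℝ) • E, hkdep, hkne, fun i j hij => ?_⟩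
  have h1 := congrFun hE (i, j)
  simp only [Φ, β, LinearMap.coe_mk, AddHom.coe_mk, hij, if_true] at h1
  rw [← h1, Finset.mul_sum, ← Finset.sum_add_distrib]
  refine Finset.sum_eq_zero fun a _ => ?_
  simp only [Pi.smul_apply, smul_eq_mul]
  ring

theorem anti_even (F : ℕ → ℕ → ℝ) (n : ℕ) (h : ∀ r s, r < n ∨ s < n → F r s = 0) :
    ∑ ij ∈ Finset.HasAntidiagonal.antidiagonal (2 * n), F ij.1 ij.2 = F n n := by
  rw [Finset.sum_eq_single (n, n)]
  · rintro ⟨r, s⟩ hrs hne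
    rw [Finset.HasAntidiagonal.mem_antidiagonal] at hrs
    apply h
    simp only at hrs ⊢
    by_contra! hcon
    apply hne
    ext <;> simp <;> omega
  · intro hn
    exact absurd (Finset.HasAntidiagonal.mem_antidiagonal.2 (by simp; omega)) hn

theorem anti_odd (F : ℕ → ℕ → ℝ) (n : ℕ) (h : ∀ r s, r ≤ n ∨ s ≤ n → F r s = 0) :
    ∑ ij ∈ Finset.HasAntidiagonal.antidiagonal (2 * n + 1), F ij.1 ij.2 = 0 := by
  refine Finset.sum_eq_zero ?_
  rintro ⟨r, s⟩ hrs
  rw [Finset.HasAntidiagonal.mem_antidiagonal] at hrs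
  apply h
  simp only at hrs ⊢
  omega

section
variable {V : Type*} [Fintype V]

theorem eform_comm (w : V → V → ℝ) (u v : V → ℝ) : eform w u v = eform w v u := by
  unfold eform
  refine Finset.sum_congr rfl fun i _ => Finset.sum_congr rfl fun j _ => by ring

theorem eform_add_left (w : V → V → ℝ) (u u' v : V → ℝ) :
    eform w (u + u') v = eform w u v + eform w u' v := by
  unfold eform
  simp only [← Finset.sum_add_distrib, Pi.add_apply]
  refine Finset.sum_congr rfl fun i _ => Finset.sum_congr rfl fun j _ => by ring

theorem eform_smul_left (w : V → V → ℝ) (c : ℝ) (u v : V → ℝ) :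
    eform w (c • u) v = c * eform w u v := by
  unfold eform
  simp only [Finset.mul_sum, Pi.smul_apply, smul_eq_mul]
  refine Finset.sum_congr rfl fun i _ => Finset.sum_congr rfl fun j _ => by ring

theorem eform_null {w : V → V → ℝ} {U : Submodule ℝ (V → ℝ)} (hU : ∀ u ∈ U, 0 ≤ eform w u u)
    {u v : V → ℝ} (hu : u ∈ U) (hv : v ∈ U) (h0 : eform w u u = 0) : eform w u v = 0 := by
  by_contra hne
  have key : ∀ t : ℝ, 0 ≤ eform w v v + 2 * t * eform w u v := by
    intro t
    have := hU (v + t • u) (U.add_mem hv (U.smul_mem t hu))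
    have e1 : eform w (v + t • u) (v + t • u) =
        eform w v v + 2 * t * eform w u v + t ^ 2 * eform w u u := by
      rw [eform_add_left, eform_smul_left, eform_comm w v, eform_comm w u, eform_add_left,
        eform_add_left, eform_smul_left, eform_smul_left, eform_comm w v u]
      ring
    rw [e1, h0] at this
    linarith
  have := key (-(eform w v v + 1) / (2 * eform w u v))
  have h2 : 2 * (-(eform w v v + 1) / (2 * eform w u v)) * eform w u v = -(eform w v v + 1) := by
    field_simp
  rw [h2] at this
  linarith
end

theorem hard_direction {V : Type*} [Fintype V] [DecidableEq V] {d : ℕ} {G : SimpleGraph V}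
    {p : Config V d} (hgen : Generic p) (hcard : d + 1 ≤ Fintype.card V)
    (h : UniversallyRigid G p) :
    ∃ Ω : Matrix V V ℝ, IsStressMatrix G p Ω ∧ Ω.PosSemidef ∧
        Module.finrank ℝ (LinearMap.ker Ω.mulVecLin) = d + 1 := by
  by_contra hno
  obtain ⟨m, k, E, hkdep, ⟨b₀, hb₀⟩, hedge⟩ := stiemke hgen hcard hno
  obtain ⟨D, hD, hD', hDp⟩ := exists_derivation_of_algebraicIndependent
    (fun x : V × Fin d => p x.1 x.2) hgen (fun x => E x.2 x.1)
  have hDp' : ∀ i a, D (p i a) = E a i := fun i a => hDp (i, a)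
  have hDsub : ∀ x y, D (x - y) = D x - D y := fun x y => map_sub (AddMonoidHom.mk' D hD) x y
  let K : Fin m → ℕ → V → ℝ := fun b n i => dpow D n (k b i)
  let P : Fin d → ℕ → V → ℝ := fun a n i => dpow D n (p i a)
  have hdsub : ∀ n x y, dpow D n (x - y) = dpow D n x - dpow D n y :=
    fun n x y => map_sub (dpowHom D hD n) x y
  -- the prolonged edge identities
  have hprol : ∀ n i j, G.Adj i j →
      ∑ b, ∑ rs ∈ Finset.HasAntidiagonal.antidiagonal n,
        (K b rs.1 i - K b rs.1 j) * (K b rs.2 i - K b rs.2 j) +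
      (n + 1) * ∑ a, ∑ rs ∈ Finset.HasAntidiagonal.antidiagonal (n + 1),
        (P a rs.1 i - P a rs.1 j) * (P a rs.2 i - P a rs.2 j) = 0 := by
    intro n i j hij
    have h1 : ∑ b, (k b i - k b j) * (k b i - k b j) +
        ∑ a, D ((p i a - p j a) * (p i a - p j a)) = 0 := by
      rw [← hedge i j hij, Finset.mul_sum]
      congr 1
      · exact Finset.sum_congr rfl fun b _ => (sq _).symm
      · refine Finset.sum_congr rfl fun a _ => ?_
        rw [hD', hDsub, hDp', hDp']
        ring
    have h2 := congrArg (dpowHom D hD n) h1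
    rw [map_add, map_sum, map_sum, map_zero] at h2
    rw [← h2, Finset.mul_sum]
    congr 1
    · refine Finset.sum_congr rfl fun b _ => ?_
      change _ = dpow D n _
      rw [dpow_mul D hD hD']
      simp only [hdsub, K]
    · refine Finset.sum_congr rfl fun a _ => ?_
      change _ = dpow D n (D _)
      rw [dpow_succ', dpow_mul D hD hD']
      simp only [hdsub, P]
  let U : Submodule ℝ (V → ℝ) := Submodule.span ℝ
    ({u | ∃ b n, u = K b n} ∪ {u | ∃ a n, u = P a n})
  have hKU : ∀ b n, K b n ∈ U := fun b n => Submodule.subset_span (Or.inl ⟨b, n, rfl⟩)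
  have hPU : ∀ a n, P a n ∈ U := fun a n => Submodule.subset_span (Or.inr ⟨a, n, rfl⟩)
  have hK0 : ∀ b, K b 0 = k b := fun b => funext fun i => dpow_zero D _
  have hP0 : ∀ a, P a 0 = fun i => p i a := fun a => funext fun i => dpow_zero D _
  let B := Module.finBasis ℝ U
  have hrep : ∀ u : U, ∀ i, (u : V → ℝ) i = ∑ r, B.repr u r * (B r : V → ℝ) i := by
    intro u i
    have := congrArg (fun v : U => (v : V → ℝ) i) (B.sum_repr u)
    simp only [Submodule.coe_sum, Finset.sum_apply, Submodule.coe_smul, Pi.smul_apply,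
      smul_eq_mul] at this
    exact this.symm
  obtain ⟨w, hw1, hw2, hw3, r₀, hr₀⟩ := facial h (fun r => (B r : V → ℝ))
    (fun a r => B.repr ⟨P a 0, hPU a 0⟩ r)
    (fun a i => by rw [← hrep ⟨P a 0, hPU a 0⟩ i]; exact (congrFun (hP0 a) i).symm)
    (k b₀) (hkdep b₀).1 (hkdep b₀).2 (by
      by_contra! hcon
      apply hb₀
      have h0 : ∑ i, k b₀ i * k b₀ i = 0 := by
        have h1 : ∀ i, k b₀ i = ∑ r, B.repr ⟨K b₀ 0, hKU b₀ 0⟩ r * (B r : V → ℝ) i := by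
          intro i
          rw [← hrep ⟨K b₀ 0, hKU b₀ 0⟩ i]
          exact (congrFun (hK0 b₀) i).symm
        calc ∑ i, k b₀ i * k b₀ i
            = ∑ i, k b₀ i * ∑ r, B.repr ⟨K b₀ 0, hKU b₀ 0⟩ r * (B r : V → ℝ) i :=
              Finset.sum_congr rfl fun i _ => by rw [← h1 i]
          _ = ∑ r, B.repr ⟨K b₀ 0, hKU b₀ 0⟩ r * ∑ i, k b₀ i * (B r : V → ℝ) i := by
              simp only [Finset.mul_sum]
              rw [Finset.sum_comm]
              refine Finset.sum_congr rfl fun i _ => Finset.sum_congr rfl fun j _ => by ring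
          _ = 0 := by simp [hcon]
      rw [Finset.sum_eq_zero_iff_of_nonneg fun i _ => mul_self_nonneg _] at h0
      ext i
      exact mul_self_eq_zero.1 (h0 i (Finset.mem_univ _)))
  have hpsd : ∀ u ∈ U, 0 ≤ eform w u u := by
    intro u hu
    have := hw2 (fun r => B.repr ⟨u, hu⟩ r)
    have he : (fun i => ∑ r, B.repr ⟨u, hu⟩ r * (B r : V → ℝ) i) = u :=
      funext fun i => (hrep ⟨u, hu⟩ i).symm
    rwa [he] at this
  have hsum : ∀ n : ℕ, ∑ b, ∑ rs ∈ Finset.HasAntidiagonal.antidiagonal n,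
        eform w (K b rs.1) (K b rs.2) +
      (n + 1) * ∑ a, ∑ rs ∈ Finset.HasAntidiagonal.antidiagonal (n + 1),
        eform w (P a rs.1) (P a rs.2) = 0 := by
    intro n
    have hpull : ∀ {κ : Type} [Fintype κ] (F : κ → ℕ → V → ℝ) (N : ℕ),
        ∑ b, ∑ rs ∈ Finset.HasAntidiagonal.antidiagonal N, eform w (F b rs.1) (F b rs.2) =
        ∑ i, ∑ j, w i j * ∑ b, ∑ rs ∈ Finset.HasAntidiagonal.antidiagonal N,
          (F b rs.1 i - F b rs.1 j) * (F b rs.2 i - F b rs.2 j) := by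
      intro κ _ F N
      simp only [eform, Finset.mul_sum]
      have h1 : ∀ b, ∑ rs ∈ Finset.HasAntidiagonal.antidiagonal N, ∑ i, ∑ j,
          w i j * ((F b rs.1 i - F b rs.1 j) * (F b rs.2 i - F b rs.2 j)) =
          ∑ i, ∑ j, ∑ rs ∈ Finset.HasAntidiagonal.antidiagonal N,
          w i j * ((F b rs.1 i - F b rs.1 j) * (F b rs.2 i - F b rs.2 j)) := by
        intro b
        rw [Finset.sum_comm]
        refine Finset.sum_congr rfl fun i _ => ?_
        rw [Finset.sum_comm]
      simp only [h1]
      rw [Finset.sum_comm]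
      refine Finset.sum_congr rfl fun i _ => ?_
      rw [Finset.sum_comm]
    rw [hpull, hpull, Finset.mul_sum, ← Finset.sum_add_distrib]
    refine Finset.sum_eq_zero fun i _ => ?_
    rw [Finset.mul_sum, ← Finset.sum_add_distrib]
    refine Finset.sum_eq_zero fun j _ => ?_
    by_cases hij : G.Adj i j
    · have := hprol n i j hij
      linear_combination w i j * this
    · simp [hw1 i j hij]
  have hnull : ∀ {κ : Type} (F : κ → ℕ → V → ℝ), (∀ b n, F b n ∈ U) → ∀ b r s,
      (eform w (F b r) (F b r) = 0 ∨ eform w (F b s) (F b s) = 0) →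
      eform w (F b r) (F b s) = 0 := by
    intro κ F hF b r s hrs
    rcases hrs with hrs | hrs
    · exact eform_null hpsd (hF b r) (hF b s) hrs
    · rw [eform_comm]
      exact eform_null hpsd (hF b s) (hF b r) hrs
  have hzero : ∀ {κ : Type} [Fintype κ] (F : κ → ℕ → V → ℝ) (n : ℕ), (∀ b n, F b n ∈ U) →
      ∑ b, eform w (F b n) (F b n) = 0 → ∀ b, eform w (F b n) (F b n) = 0 := by
    intro κ _ F n hF h0 b
    rw [Finset.sum_eq_zero_iff_of_nonneg fun b _ => hpsd _ (hF b n)] at h0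
    exact h0 b (Finset.mem_univ _)
  have hind : ∀ n, (∀ r < n, ∀ b, eform w (K b r) (K b r) = 0) ∧
      (∀ r ≤ n, ∀ a, eform w (P a r) (P a r) = 0) := by
    intro n
    induction n with
    | zero =>
      refine ⟨fun r hr => by omega, fun r hr => ?_⟩
      obtain rfl : r = 0 := by omega
      refine hzero P 0 hPU ?_
      simp only [hP0]
      exact hw3
    | succ n ih =>
      obtain ⟨ihK, ihP⟩ := ih
      have hKn : ∀ b, eform w (K b n) (K b n) = 0 := by
        refine hzero K n hKU ?_
        have h1 := hsum (2 * n)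
        rw [Finset.sum_congr rfl fun b _ => anti_even (fun r s => eform w (K b r) (K b s)) n
          (fun r s hrs => hnull K hKU b r s (hrs.imp (fun h => ihK r h b) (fun h => ihK s h b))),
          Finset.sum_congr rfl fun a _ => anti_odd (fun r s => eform w (P a r) (P a s)) n
          (fun r s hrs => hnull P hPU a r s (hrs.imp (fun h => ihP r h a) (fun h => ihP s h a)))]
          at h1
        simpa using h1
      have hK' : ∀ r ≤ n, ∀ b, eform w (K b r) (K b r) = 0 := by
        intro r hr
        rcases hr.eq_or_lt with rfl | hr
        · exact hKn
        · exact ihK r hr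
      have hPn : ∀ a, eform w (P a (n + 1)) (P a (n + 1)) = 0 := by
        refine hzero P (n + 1) hPU ?_
        have h1 := hsum (2 * n + 1)
        rw [Finset.sum_congr rfl fun b _ => anti_odd (fun r s => eform w (K b r) (K b s)) n
          (fun r s hrs => hnull K hKU b r s (hrs.imp (fun h => hK' r h b) (fun h => hK' s h b))),
          show 2 * n + 1 + 1 = 2 * (n + 1) by ring,
          Finset.sum_congr rfl fun a _ => anti_even (fun r s => eform w (P a r) (P a s)) (n + 1)
          (fun r s hrs => hnull P hPU a r s (hrs.imp (fun h => ihP r (by omega) a)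
            (fun h => ihP s (by omega) a)))] at h1
        simp only [Finset.sum_const_zero, zero_add] at h1
        rcases mul_eq_zero.1 h1 with h2 | h2
        · exfalso
          have : (0 : ℝ) < ((2 * n + 1 : ℕ) : ℝ) + 1 := by positivity
          exact this.ne' h2
        · exact h2
      refine ⟨fun r hr => hK' r (by omega), fun r hr => ?_⟩
      rcases hr.eq_or_lt with rfl | hr
      · exact hPn
      · exact ihP r (by omega)
  apply hr₀
  have hall : ∀ u ∈ U, ∀ v ∈ U, eform w u v = 0 := by
    intro u hu v hv
    induction hu using Submodule.span_induction with
    | mem u hu =>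
      rcases hu with ⟨b, n, rfl⟩ | ⟨a, n, rfl⟩
      · exact eform_null hpsd (hKU b n) hv ((hind (n + 1)).1 n (by omega) b)
      · exact eform_null hpsd (hPU a n) hv ((hind n).2 n le_rfl a)
    | zero => simp [eform]
    | add x y _ _ hx hy => rw [eform_add_left, hx, hy, add_zero]
    | smul c x _ hx => rw [eform_smul_left, hx, mul_zero]
  exact hall _ (B r₀).2 _ (B r₀).2

theorem psd_mulVec_zero {V : Type*} [Fintype V] {Ω : Matrix V V ℝ} (h : Ω.PosSemidef)
    (u : V → ℝ) (hu : u ⬝ᵥ Ω.mulVec u = 0) : Ω.mulVec u = 0 := by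
  classical
  exact (h.dotProduct_mulVec_zero_iff u).1 (by simpa using hu)

theorem stress_energy {V : Type*} [Fintype V] {Ω : Matrix V V ℝ} (hs : Ω.IsSymm)
    (h1 : ∀ i, ∑ j, Ω i j = 0) (u : V → ℝ) :
    ∑ i, ∑ j, Ω i j * (u i - u j) ^ 2 = -2 * (u ⬝ᵥ Ω.mulVec u) := by
  have hA : ∑ i, ∑ j, Ω i j * u i ^ 2 = 0 := by
    refine Finset.sum_eq_zero fun i _ => ?_
    rw [← Finset.sum_mul, h1, zero_mul]
  have hB : ∑ i, ∑ j, Ω i j * u j ^ 2 = 0 := by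
    rw [Finset.sum_comm, ← hA]
    refine Finset.sum_congr rfl fun i _ => Finset.sum_congr rfl fun j _ => ?_
    rw [hs.apply]
  have hC : u ⬝ᵥ Ω.mulVec u = ∑ i, ∑ j, Ω i j * (u i * u j) := by
    simp only [dotProduct, Matrix.mulVec, Finset.mul_sum]
    refine Finset.sum_congr rfl fun i _ => Finset.sum_congr rfl fun j _ => by ring
  rw [hC]
  calc _ = ∑ i, ∑ j, Ω i j * u i ^ 2 + ∑ i, ∑ j, Ω i j * u j ^ 2 +
        -2 * ∑ i, ∑ j, Ω i j * (u i * u j) := by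
        simp only [Finset.mul_sum, ← Finset.sum_add_distrib]
        refine Finset.sum_congr rfl fun i _ => Finset.sum_congr rfl fun j _ => by ring
    _ = _ := by rw [hA, hB]; ring

theorem easy_direction {V : Type*} [Fintype V] [DecidableEq V] {d : ℕ} {G : SimpleGraph V}
    {p : Config V d} (hgen : Generic p) (hcard : d + 2 ≤ Fintype.card V)
    {Ω : Matrix V V ℝ} (hΩ : IsStressMatrix G p Ω) (hpsd : Ω.PosSemidef)
    (hnull : Module.finrank ℝ (LinearMap.ker Ω.mulVecLin) = d + 1) :
    UniversallyRigid G p := by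
  obtain ⟨hs, hG, h1, h2⟩ := hΩ
  rw [stress_coord] at h2
  have hker : LinearMap.range (affMap p) = LinearMap.ker Ω.mulVecLin := by
    refine Submodule.eq_of_le_of_finrank_eq ?_ ?_
    · rintro _ ⟨x, rfl⟩
      exact affMap_mulVec h1 h2 x
    · rw [hnull, finrank_range_affMap hgen (by omega)]
  intro d' _ q hq
  have hdp : ∀ i j, dist (p i) (p j) ^ 2 = ∑ a, (p i a - p j a) ^ 2 := by
    intro i j
    rw [EuclideanSpace.dist_eq, Real.sq_sqrt (Finset.sum_nonneg fun _ _ => sq_nonneg _)]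
    simp [Real.dist_eq, sq_abs]
  have hdq : ∀ i j, dist (q i) (q j) ^ 2 = ∑ a, (q i a - q j a) ^ 2 := by
    intro i j
    rw [EuclideanSpace.dist_eq, Real.sq_sqrt (Finset.sum_nonneg fun _ _ => sq_nonneg _)]
    simp [Real.dist_eq, sq_abs]
  let D : V → V → ℝ := fun i j => ∑ a, (q i a - q j a) ^ 2 - ∑ a, (p i a - p j a) ^ 2
  have hD : ∀ i j, Ω i j ≠ 0 → D i j = 0 := by
    intro i j hij
    by_cases h : i = j
    · subst h; simp [D]
    · have : G.Adj i j := by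
        by_contra hcon
        exact hij (hG i j h hcon)
      simp only [D, ← hdp, ← hdq, hq i j this, sub_self]
  have hpk : ∀ a, Ω.mulVec (fun i => p i a) = 0 := fun a => funext fun i => h2 i a
  -- the new coordinates lie in the kernel
  have hqk : ∀ r, Ω.mulVec (fun i => q i r) = 0 := by
    have hsum : ∑ r, ((fun i => q i r) ⬝ᵥ Ω.mulVec (fun i => q i r)) = 0 := by
      have e1 : ∑ i, ∑ j, Ω i j * D i j = 0 :=
        Finset.sum_eq_zero fun i _ => Finset.sum_eq_zero fun j _ => by
          by_cases h : Ω i j = 0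
          · simp [h]
          · simp [hD i j h]
      have e2 : ∀ {n : ℕ} (f : Config V n), ∑ i, ∑ j, Ω i j * ∑ r, (f i r - f j r) ^ 2 =
          -2 * ∑ r, ((fun i => f i r) ⬝ᵥ Ω.mulVec (fun i => f i r)) := by
        intro n f
        rw [Finset.mul_sum]
        simp only [← stress_energy hs h1, Finset.mul_sum]
        conv_rhs => rw [Finset.sum_comm]
        refine Finset.sum_congr rfl fun i _ => ?_
        rw [Finset.sum_comm]
      simp only [D, mul_sub, Finset.sum_sub_distrib, e2, hpk] at e1
      simp at e1
      exact e1
    intro r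
    apply psd_mulVec_zero hpsd
    rw [Finset.sum_eq_zero_iff_of_nonneg fun r _ => by
      simpa using hpsd.dotProduct_mulVec_nonneg (fun i => q i r)] at hsum
    exact hsum r (Finset.mem_univ _)
  have hDrow : ∀ i k, ∑ j, Ω k j * D i j =
      ∑ j, Ω k j * (∑ a, q j a ^ 2 - ∑ a, p j a ^ 2) := by
    have e2 : ∀ {n : ℕ} (f : Config V n), (∀ r, Ω.mulVec (fun i => f i r) = 0) → ∀ i k,
        ∑ j, Ω k j * ∑ r, (f i r - f j r) ^ 2 = ∑ j, Ω k j * ∑ r, f j r ^ 2 := by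
      intro n f hf i k
      simp only [Finset.mul_sum]
      rw [Finset.sum_comm]
      conv_rhs => rw [Finset.sum_comm]
      refine Finset.sum_congr rfl fun r _ => ?_
      have e3 : ∑ j, Ω k j * f j r = 0 := congrFun (hf r) k
      calc _ = (∑ j, Ω k j) * f i r ^ 2 - 2 * f i r * (∑ j, Ω k j * f j r) +
            ∑ j, Ω k j * f j r ^ 2 := by
            simp only [Finset.sum_mul, Finset.mul_sum, ← Finset.sum_add_distrib,
              ← Finset.sum_sub_distrib]
            refine Finset.sum_congr rfl fun j _ => by ring
        _ = _ := by rw [e3, h1]; ring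
    intro i k
    simp only [D, mul_sub, Finset.sum_sub_distrib]
    rw [e2 q hqk, e2 p hpk]
  have hDk : ∀ i, D i ∈ LinearMap.range (affMap p) := by
    intro i
    rw [hker, LinearMap.mem_ker]
    ext k
    change ∑ j, Ω k j * D i j = 0
    rw [hDrow, ← hDrow k]
    refine Finset.sum_eq_zero fun j _ => ?_
    by_cases h : Ω k j = 0
    · simp [h]
    · simp [hD k j h]
  have hD0 : ∀ i j, D i j = 0 := by
    intro i
    let S : Finset V := Finset.univ.filter fun j => Ω i j ≠ 0
    have hrow : ∃ j, Ω i j ≠ 0 := by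
      by_contra! hcon
      have hmem : (Pi.single i 1 : V → ℝ) ∈ LinearMap.range (affMap p) := by
        rw [hker, LinearMap.mem_ker]
        ext k
        simp [hs.apply k i ▸ hcon k]
      obtain ⟨x, hx⟩ := hmem
      have := affine_vanish hgen (Finset.univ.erase i)
        (by rw [Finset.card_erase_of_mem (Finset.mem_univ _), Finset.card_univ]; omega) x.1 x.2
        (fun k hk => by
          rw [← affMap_apply, hx]
          simp [Finset.ne_of_mem_erase hk])
      have h3 := congrFun hx i
      rw [affMap_apply, this.1, this.2] at h3
      simp at h3
    have hScard : d + 1 ≤ S.card := by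
      by_contra! hlt
      obtain ⟨j, hj⟩ := hrow
      obtain ⟨S', hSS', hS'⟩ := Finset.exists_superset_card_eq (s := S) (n := d + 1) hlt.le
        (by omega)
      have hjS : j ∈ S' := hSS' (Finset.mem_filter.2 ⟨Finset.mem_univ _, hj⟩)
      let L : (ℝ × (Fin d → ℝ)) →ₗ[ℝ] (S' → ℝ) :=
        LinearMap.funLeft ℝ ℝ (fun k : S' => (k : V)) ∘ₗ affMap p
      have hLinj : Function.Injective L := by
        rw [injective_iff_map_eq_zero]
        intro x hx
        have := affine_vanish hgen S' hS'.ge x.1 x.2 (fun k hk => congrFun hx ⟨k, hk⟩)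
        exact Prod.ext this.1 this.2
      have hLsurj : Function.Surjective L :=
        (LinearMap.injective_iff_surjective_of_finrank_eq_finrank (by
          simp [hS', add_comm])).1 hLinj
      obtain ⟨x, hx⟩ := hLsurj (Pi.single ⟨j, hjS⟩ 1)
      have hx' : ∀ k (hk : k ∈ S'), affMap p x k = (Pi.single ⟨j, hjS⟩ 1 : S' → ℝ) ⟨k, hk⟩ :=
        fun k hk => congrFun hx ⟨k, hk⟩
      have h3 : ∑ k, Ω i k * affMap p x k = 0 := affMap_dep (v := Ω i) ⟨h1 i, h2 i⟩ x
      rw [Finset.sum_eq_single j] at h3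
      · rw [hx' j hjS] at h3
        simp at h3
        exact hj h3
      · intro k _ hk
        by_cases h : Ω i k = 0
        · simp [h]
        · rw [hx' k (hSS' (Finset.mem_filter.2 ⟨Finset.mem_univ _, h⟩))]
          simp [Pi.single_apply, hk]
      · simp
    obtain ⟨x, hx⟩ := hDk i
    have := affine_vanish hgen S hScard x.1 x.2 (fun k hk => by
      rw [← affMap_apply, hx]
      exact hD i k (Finset.mem_filter.1 hk).2)
    intro j
    rw [← hx, affMap_apply, this.1, this.2]
    simp
  intro i j
  have := hD0 i j
  simp only [D, ← hdp, ← hdq] at this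
  exact (sq_eq_sq₀ dist_nonneg dist_nonneg).1 (by linarith)

/-- A generic framework in `ℝ^d` with at least `d + 2` vertices is universally rigid if
and only if it has a positive semidefinite stress matrix of nullity `d + 1`. -/
theorem universallyRigid_iff_exists_psd_stressMatrix
    {V : Type*} [Fintype V] [DecidableEq V] {d : ℕ}
    (G : SimpleGraph V) (p : Config V d)
    (hcard : d + 2 ≤ Fintype.card V)
    (hgen : Generic p) :
    UniversallyRigid G p ↔
      ∃ Ω : Matrix V V ℝ, IsStressMatrix G p Ω ∧ Ω.PosSemidef ∧
        Module.finrank ℝ (LinearMap.ker Ω.mulVecLin) = d + 1 := by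
  constructor
  · exact hard_direction hgen (by omega)
  · rintro ⟨Ω, hΩ, hpsd, hnull⟩
    exact easy_direction hgen hcard hΩ hpsd hnull
end
end

section
/- Let G(p) be a framework in ℝ^d with at least d + 2 vertices whose configuration p is in general position. If there exists a positive semidefinite stress matrix of G(p) of nullity d + 1, then G(p) is universally rigid. -/
open scoped BigOperators

noncomputable section

lemma aux_row {V : Type*} [Fintype V] {m : ℕ} (Ω : Matrix V V ℝ)
    (hrow : ∀ i, ∑ j, Ω i j = 0) (q : Config V m) (k i : V) :
    ∑ j, Ω k j * dist (q i) (q j) ^ 2 =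
      ∑ j, Ω k j * ‖q j‖ ^ 2 - 2 * inner ℝ (q i) (∑ j, Ω k j • q j) := by
  have h : ∀ j, Ω k j * dist (q i) (q j) ^ 2 =
      Ω k j * ‖q i‖ ^ 2 + (Ω k j * ‖q j‖ ^ 2 - 2 * inner ℝ (q i) (Ω k j • q j)) := by
    intro j
    rw [dist_eq_norm, norm_sub_sq_real, inner_smul_right]
    ring
  rw [Finset.sum_congr rfl (fun j _ => h j), Finset.sum_add_distrib, ← Finset.sum_mul, hrow,
    Finset.sum_sub_distrib, ← Finset.mul_sum, inner_sum]
  ring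

lemma aux_energy {V : Type*} [Fintype V] {m : ℕ} (Ω : Matrix V V ℝ) (hs : Ω.IsSymm)
    (hrow : ∀ i, ∑ j, Ω i j = 0) (q : Config V m) :
    ∑ i, ∑ j, Ω i j * dist (q i) (q j) ^ 2 =
      - 2 * ∑ i, inner ℝ (q i) (∑ j, Ω i j • q j) := by
  rw [Finset.sum_congr rfl (fun i _ => aux_row Ω hrow q i i), Finset.sum_sub_distrib,
    ← Finset.mul_sum, Finset.sum_comm]
  have : ∀ j, ∑ i, Ω i j * ‖q j‖ ^ 2 = 0 := by
    intro j
    rw [← Finset.sum_mul]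
    have : ∑ i, Ω i j = 0 := by
      rw [← hrow j]
      exact Finset.sum_congr rfl (fun i _ => hs.apply j i)
    rw [this, zero_mul]
  simp [this]

lemma aux_ker {V : Type*} [Fintype V] {m : ℕ} (Ω : Matrix V V ℝ) (hpsd : Ω.PosSemidef)
    (q : Config V m) (h : ∑ i, inner ℝ (q i) (∑ j, Ω i j • q j) = 0) :
    ∀ i, ∑ j, Ω i j • q j = 0 := by
  have h1 : ∑ a, (fun i => q i a) ⬝ᵥ (Ω.mulVec (fun i => q i a)) = 0 := by
    rw [← h]
    simp only [dotProduct, Matrix.mulVec, PiLp.inner_apply]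
    rw [Finset.sum_comm]
    refine Finset.sum_congr rfl fun i _ => Finset.sum_congr rfl fun a _ => ?_
    simp [mul_comm]
  have h2 : ∀ a, 0 ≤ (fun i => q i a) ⬝ᵥ (Ω.mulVec (fun i => q i a)) := by
    intro a
    simpa using hpsd.dotProduct_mulVec_nonneg (fun i => q i a)
  rw [Finset.sum_eq_zero_iff_of_nonneg (fun a _ => h2 a)] at h1
  intro i
  ext a
  have h3 := (hpsd.dotProduct_mulVec_zero_iff (fun i => q i a)).1
    (by simpa using h1 a (Finset.mem_univ _))
  have := congrFun h3 i
  simpa [Matrix.mulVec, dotProduct] using this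

/-- affine functions evaluated on a configuration -/
def affEval {V : Type*} {d : ℕ} (p : Config V d) :
    (EuclideanSpace ℝ (Fin d) × ℝ) →ₗ[ℝ] (V → ℝ) where
  toFun c := fun j => inner ℝ c.1 (p j) + c.2
  map_add' x y := by
    funext j
    simp [inner_add_left]
    ring
  map_smul' r x := by
    funext j
    simp [inner_smul_left]
    ring

lemma aux_aff {V : Type*} {d : ℕ} (p : Config V d) (hgen : InGeneralPosition d p)
    (S : Finset V) (hS : S.card = d + 1) (c : EuclideanSpace ℝ (Fin d) × ℝ)
    (h : ∀ j ∈ S, affEval p c j = 0) : c = 0 := by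
  have hne : S.Nonempty := Finset.card_pos.1 (by omega)
  obtain ⟨s, hs⟩ := hne
  have ht : vectorSpan ℝ (Set.range (fun i : S => p i.1)) = ⊤ := by
    apply (hgen S hS).vectorSpan_eq_top_of_card_eq_finrank_add_one
    simp [hS]
  have hc : c.1 = 0 := by
    have hle : vectorSpan ℝ (Set.range (fun i : S => p i.1)) ≤
        LinearMap.ker (innerₛₗ ℝ c.1) := by
      rw [vectorSpan_def, Submodule.span_le]
      rintro _ ⟨_, ⟨i, rfl⟩, _, ⟨j, rfl⟩, rfl⟩
      have hi := h i.1 i.2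
      have hj := h j.1 j.2
      simp only [affEval, LinearMap.coe_mk, AddHom.coe_mk] at hi hj
      simp [inner_sub_right]
      linarith
    rw [ht] at hle
    have : c.1 ∈ LinearMap.ker (innerₛₗ ℝ c.1) := hle trivial
    simpa using this
  have h2 := h s hs
  simp [affEval, hc] at h2
  exact Prod.ext hc h2

lemma aux_vanish {V : Type*} [Fintype V] {d : ℕ} (G : SimpleGraph V) (p : Config V d)
    (hgen : InGeneralPosition d p) (Ω : Matrix V V ℝ) (hΩ : IsStressMatrix G p Ω)
    (hnull : Module.finrank ℝ (LinearMap.ker Ω.mulVecLin) = d + 1)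
    (S : Finset V) (hS : d + 1 ≤ S.card) (x : V → ℝ) (hx : Ω.mulVec x = 0)
    (h : ∀ j ∈ S, x j = 0) : x = 0 := by
  obtain ⟨S', hS', hc⟩ := Finset.exists_subset_card_eq hS
  obtain ⟨-, -, hrow, hp⟩ := hΩ
  have hinj : Function.Injective (affEval p) := by
    rw [← LinearMap.ker_eq_bot, LinearMap.ker_eq_bot']
    intro c h0
    exact aux_aff p hgen S' hc c (fun j _ => by rw [h0]; rfl)
  have hle : LinearMap.range (affEval p) ≤ LinearMap.ker Ω.mulVecLin := by
    rintro _ ⟨c, rfl⟩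
    rw [LinearMap.mem_ker]
    funext i
    have : ∑ j, Ω i j * (inner ℝ c.1 (p j) + c.2) =
        inner ℝ c.1 (∑ j, Ω i j • p j) + (∑ j, Ω i j) * c.2 := by
      simp only [inner_sum, inner_smul_right, mul_add, Finset.sum_add_distrib, Finset.sum_mul]
    rw [hp, hrow] at this
    simpa [Matrix.mulVec, dotProduct, affEval] using this
  have heq := Submodule.eq_of_le_of_finrank_eq hle (by
    rw [LinearMap.finrank_range_of_inj hinj, hnull]; simp)
  have hxm : x ∈ LinearMap.range (affEval p) := by
    rw [heq]; exact hx
  obtain ⟨c, rfl⟩ := hxm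
  rw [aux_aff p hgen S' hc c (fun j hj => h j (hS' hj)), map_zero]

open Classical in
lemma aux_degree {V : Type*} [Fintype V] {d : ℕ} (G : SimpleGraph V) (p : Config V d)
    (hcard : d + 2 ≤ Fintype.card V)
    (hgen : InGeneralPosition d p) (Ω : Matrix V V ℝ) (hΩ : IsStressMatrix G p Ω)
    (hnull : Module.finrank ℝ (LinearMap.ker Ω.mulVecLin) = d + 1) (i : V) :
    d + 1 ≤ (Finset.univ.filter (fun j => i = j ∨ G.Adj i j)).card := by
  by_contra! hlt
  obtain ⟨S, hsub, hS⟩ := Finset.exists_superset_card_eq (n := d + 1) hlt.le (by omega)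
  have hΩ' := hΩ
  obtain ⟨hsymm, hz, hrow, hp⟩ := hΩ'
  have hz' : ∀ j, j ∉ S → Ω i j = 0 := by
    intro j hj
    have : ¬ (i = j ∨ G.Adj i j) := fun h => hj (hsub (by simpa using h))
    push Not at this
    exact hz i j this.1 this.2
  have hai := hgen S hS
  rw [affineIndependent_iff] at hai
  have hrowz : ∀ j, Ω i j = 0 := by
    intro j
    by_cases hj : j ∈ S
    · refine hai Finset.univ (fun j => Ω i j.1) ?_ ?_ ⟨j, hj⟩ (Finset.mem_univ _)
      · rw [Finset.univ_eq_attach, Finset.sum_attach S (fun j => Ω i j), ← hrow i]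
        exact Finset.sum_subset (Finset.subset_univ _) (fun j _ hj => hz' j hj)
      · rw [Finset.univ_eq_attach, Finset.sum_attach S (fun j => Ω i j • p j), ← hp i]
        exact Finset.sum_subset (Finset.subset_univ _) (fun j _ hj => by simp [hz' j hj])
    · exact hz' j hj
  have := aux_vanish G p hgen Ω hΩ hnull (Finset.univ.erase i)
    (by rw [Finset.card_erase_of_mem (Finset.mem_univ _), Finset.card_univ]; omega)
    (Pi.single i 1) (by
      funext k
      simp
      rw [hsymm.apply i k, hrowz]) (by
      intro j hj
      simp at hj
      simp [hj])
  have h1 := congrFun this i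
  simp at h1

/-- A framework in general position in `ℝ^d` with at least `d + 2` vertices that
possesses a positive semidefinite stress matrix of nullity `d + 1` is universally
rigid. -/
theorem universallyRigid_of_psd_stressMatrix
    {V : Type*} [Fintype V] [DecidableEq V] {d : ℕ}
    (G : SimpleGraph V) (p : Config V d)
    (hcard : d + 2 ≤ Fintype.card V)
    (hgen : InGeneralPosition d p)
    (Ω : Matrix V V ℝ) (hΩ : IsStressMatrix G p Ω) (hpsd : Ω.PosSemidef)
    (hnull : Module.finrank ℝ (LinearMap.ker Ω.mulVecLin) = d + 1) :
    UniversallyRigid G p := by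
  classical
  intro d' _ q hq
  have hΩ' := hΩ
  obtain ⟨hsymm, hz, hrow, hp⟩ := hΩ'
  have hmul : ∀ i j, Ω i j * dist (q i) (q j) ^ 2 = Ω i j * dist (p i) (p j) ^ 2 := by
    intro i j
    by_cases hij : i = j
    · subst hij
      simp
    · by_cases ha : G.Adj i j
      · rw [hq i j ha]
      · rw [hz i j hij ha]
        simp
  have hqk : ∀ i, ∑ j, Ω i j • q j = 0 := by
    apply aux_ker Ω hpsd
    have h1 := aux_energy Ω hsymm hrow q
    have h2 := aux_energy Ω hsymm hrow p
    simp only [hmul] at h1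
    rw [h1] at h2
    simp only [hp, inner_zero_right, Finset.sum_const_zero, mul_zero] at h2
    linarith
  have hE : ∀ k i, ∑ j, Ω k j * (dist (q i) (q j) ^ 2 - dist (p i) (p j) ^ 2) =
      ∑ j, Ω k j * (‖q j‖ ^ 2 - ‖p j‖ ^ 2) := by
    intro k i
    have h1 := aux_row Ω hrow q k i
    have h2 := aux_row Ω hrow p k i
    rw [hqk, inner_zero_right] at h1
    rw [hp, inner_zero_right] at h2
    simp only [mul_sub, Finset.sum_sub_distrib]
    linarith
  have ha : ∀ k, ∑ j, Ω k j * (‖q j‖ ^ 2 - ‖p j‖ ^ 2) = 0 := by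
    intro k
    rw [← hE k k]
    exact Finset.sum_eq_zero (fun j _ => by rw [mul_sub, hmul, sub_self])
  intro i j
  have hv := aux_vanish G p hgen Ω hΩ hnull _ (aux_degree G p hcard hgen Ω hΩ hnull i)
    (fun j => dist (q i) (q j) ^ 2 - dist (p i) (p j) ^ 2)
    (by
      funext k
      exact (hE k i).trans (ha k))
    (by
      intro j hj
      simp only [Finset.mem_filter, Finset.mem_univ, true_and] at hj
      rcases hj with rfl | hj
      · simp
      · rw [hq i j hj, sub_self])
  have h1 : dist (q i) (q j) ^ 2 - dist (p i) (p j) ^ 2 = 0 := congrFun hv j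
  exact (pow_left_inj₀ dist_nonneg dist_nonneg two_ne_zero).1 (by linarith)
end
end

section
/- Let Ω₁ be a positive semidefinite real symmetric n × n matrix and let Ω₂ be a real symmetric n × n matrix such that the kernel of Ω₁ is contained in the kernel of Ω₂. Then there exists c > 0 such that c·Ω₁ + Ω₂ is positive semidefinite and has the same nullity as Ω₁. -/
open scoped Matrix MatrixOrder Matrix.Norms.L2Operator

theorem quad_lower_bound_aux {n : Type*} [Fintype n] (S : Matrix n n ℝ) (y : n → ℝ) :
    -((∑ i, ∑ j, |S i j|) * (y ⬝ᵥ y)) ≤ y ⬝ᵥ (S *ᵥ y) := by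
  have hle : ∀ i, y i ^ 2 ≤ y ⬝ᵥ y := by
    intro i
    have := Finset.single_le_sum (f := fun i => y i * y i)
      (fun i _ => mul_self_nonneg (y i)) (Finset.mem_univ i)
    simpa [dotProduct, sq] using this
  have hexp : y ⬝ᵥ (S *ᵥ y) = ∑ i, ∑ j, y i * (S i j * y j) := by
    simp [dotProduct, Matrix.mulVec, Finset.mul_sum]
  rw [hexp, Finset.sum_mul, ← Finset.sum_neg_distrib]
  refine Finset.sum_le_sum fun i _ => ?_
  rw [Finset.sum_mul, ← Finset.sum_neg_distrib]
  refine Finset.sum_le_sum fun j _ => ?_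
  have h1 : |y i * y j| ≤ y ⬝ᵥ y := by
    rw [abs_le]
    constructor <;> nlinarith [hle i, hle j, sq_nonneg (y i + y j), sq_nonneg (y i - y j)]
  have h2 : |y i * (S i j * y j)| ≤ |S i j| * (y ⬝ᵥ y) := by
    rw [mul_left_comm, abs_mul]
    exact mul_le_mul_of_nonneg_left h1 (abs_nonneg _)
  exact (abs_le.1 h2).1

theorem exists_ginverse_aux {V W : Type*} [AddCommGroup V] [Module ℝ V] [AddCommGroup W]
    [Module ℝ W] (f : V →ₗ[ℝ] W) : ∃ g : W →ₗ[ℝ] V, ∀ x, f (g (f x)) = f x := by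
  obtain ⟨g₀, hg₀⟩ := f.rangeRestrict.exists_rightInverse_of_surjective f.range_rangeRestrict
  obtain ⟨g, hg⟩ := LinearMap.exists_extend g₀
  refine ⟨g, fun x => ?_⟩
  have e1 : g (f x) = g₀ (f.rangeRestrict x) := by
    rw [← hg]; rfl
  have e2 := LinearMap.congr_fun hg₀ (f.rangeRestrict x)
  rw [e1]
  exact congrArg Subtype.val e2

/-- If `Ω₁` is positive semidefinite, `Ω₂` is symmetric, and `ker Ω₁ ⊆ ker Ω₂`, then
for some `c > 0` the matrix `c • Ω₁ + Ω₂` is positive semidefinite with the same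
nullity as `Ω₁`. -/
theorem exists_pos_smul_add_posSemidef {n : Type*} [Fintype n]
    (Ω₁ Ω₂ : Matrix n n ℝ)
    (h₁ : Ω₁.PosSemidef) (h₂ : Ω₂.IsSymm)
    (hker : LinearMap.ker Ω₁.mulVecLin ≤ LinearMap.ker Ω₂.mulVecLin) :
    ∃ c : ℝ, 0 < c ∧ (c • Ω₁ + Ω₂).PosSemidef ∧
      Module.finrank ℝ (LinearMap.ker (c • Ω₁ + Ω₂).mulVecLin) =
        Module.finrank ℝ (LinearMap.ker Ω₁.mulVecLin) := by
  classical
  obtain ⟨B, hB⟩ : ∃ B : Matrix n n ℝ, Ω₁ = Bᵀ * B := by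
    obtain ⟨B, hB⟩ := CStarAlgebra.nonneg_iff_eq_star_mul_self.1 h₁.nonneg
    exact ⟨B, by simpa [Matrix.star_eq_conjTranspose, Matrix.conjTranspose_eq_transpose_of_trivial] using hB⟩
  obtain ⟨g, hg⟩ := exists_ginverse_aux B.mulVecLin
  have hΩ : ∀ x, Ω₂ *ᵥ (g (B *ᵥ x)) = Ω₂ *ᵥ x := by
    intro x
    have hm : g (B *ᵥ x) - x ∈ LinearMap.ker Ω₁.mulVecLin := by
      have := hg x
      simp only [Matrix.mulVecLin_apply] at this
      rw [LinearMap.mem_ker, Matrix.mulVecLin_apply, hB, ← Matrix.mulVec_mulVec,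
        Matrix.mulVec_sub, this, sub_self, Matrix.mulVec_zero]
    have := hker hm
    rw [LinearMap.mem_ker, Matrix.mulVecLin_apply, Matrix.mulVec_sub] at this
    exact sub_eq_zero.1 this
  have hsym : ∀ x y, x ⬝ᵥ (Ω₂ *ᵥ y) = y ⬝ᵥ (Ω₂ *ᵥ x) := by
    intro x y
    rw [Matrix.dotProduct_mulVec, ← Matrix.mulVec_transpose, h₂.eq, dotProduct_comm]
  set G := LinearMap.toMatrix' g with hG
  have hGg : ∀ y, G *ᵥ y = g y := fun y => LinearMap.toMatrix'_mulVec g y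
  set K := ∑ i, ∑ j, |(Gᵀ * Ω₂ * G) i j| with hK
  have hK0 : 0 ≤ K := Finset.sum_nonneg fun i _ => Finset.sum_nonneg fun j _ => abs_nonneg _
  have hq : ∀ x, -(K * ((B *ᵥ x) ⬝ᵥ (B *ᵥ x))) ≤ x ⬝ᵥ (Ω₂ *ᵥ x) := by
    intro x
    have h := quad_lower_bound_aux (Gᵀ * Ω₂ * G) (B *ᵥ x)
    have he : (B *ᵥ x) ⬝ᵥ ((Gᵀ * Ω₂ * G) *ᵥ (B *ᵥ x)) = x ⬝ᵥ (Ω₂ *ᵥ x) := by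
      rw [← Matrix.mulVec_mulVec, ← Matrix.mulVec_mulVec, hGg, hΩ, Matrix.dotProduct_mulVec,
        Matrix.vecMul_transpose, hGg, hsym, hΩ]
    rw [he] at h
    exact h
  have hq1 : ∀ x, x ⬝ᵥ (Ω₁ *ᵥ x) = (B *ᵥ x) ⬝ᵥ (B *ᵥ x) := by
    intro x
    rw [hB, ← Matrix.mulVec_mulVec, Matrix.dotProduct_mulVec, Matrix.vecMul_transpose]
  have hmain : ∀ x, (B *ᵥ x) ⬝ᵥ (B *ᵥ x) ≤ x ⬝ᵥ (((K + 1) • Ω₁ + Ω₂) *ᵥ x) := by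
    intro x
    rw [Matrix.add_mulVec, dotProduct_add, Matrix.smul_mulVec, dotProduct_smul, hq1, smul_eq_mul]
    linarith [hq x]
  have hnn : ∀ x, 0 ≤ (B *ᵥ x) ⬝ᵥ (B *ᵥ x) := fun x =>
    Finset.sum_nonneg fun i _ => mul_self_nonneg _
  refine ⟨K + 1, by linarith, ?_, ?_⟩
  · refine Matrix.PosSemidef.of_dotProduct_mulVec_nonneg ?_ fun x => ?_
    · have h3 : Ω₂.IsHermitian := by
        rw [Matrix.IsHermitian, Matrix.conjTranspose_eq_transpose_of_trivial, h₂.eq]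
      refine Matrix.IsHermitian.add ?_ h3
      have h4 : Ω₁ᴴ = Ω₁ := h₁.1
      rw [Matrix.IsHermitian, Matrix.conjTranspose_smul, h4, star_trivial]
    · simpa using (hnn x).trans (hmain x)
  · have : LinearMap.ker ((K + 1) • Ω₁ + Ω₂).mulVecLin = LinearMap.ker Ω₁.mulVecLin := by
      ext x
      constructor
      · intro hx
        rw [LinearMap.mem_ker, Matrix.mulVecLin_apply] at hx ⊢
        have h := hmain x
        rw [hx, dotProduct_zero] at h
        have hz : B *ᵥ x = 0 := dotProduct_self_eq_zero.1 (le_antisymm h (hnn x))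
        rw [hB, ← Matrix.mulVec_mulVec, hz, Matrix.mulVec_zero]
      · intro hx
        have hx2 := hker hx
        rw [LinearMap.mem_ker, Matrix.mulVecLin_apply] at hx hx2 ⊢
        rw [Matrix.add_mulVec, Matrix.smul_mulVec, hx, hx2]
        simp
    rw [this]
end

section
/- Let G_A(p_A) and G_B(p_B) be universally rigid frameworks in ℝ^d whose configurations are in general position, whose shared vertex set V_C = V_A ∩ V_B satisfies |V_C| ≥ d + 1 and is a proper subset of both V_A and V_B, and whose configurations agree on V_C. Then the edge-reduced framework attachment, obtained from the framework attachment by deleting every edge {i, j} with i, j ∈ V_C that lies in E_B but not in E_A, is universally rigid. -/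
noncomputable section

/-- The configuration `p`, restricted to the vertex subset `A`, is in general
position. -/
def InGeneralPositionOn {V : Type*} (d : ℕ) (A : Finset V) (p : Config V d) : Prop :=
  ∀ S : Finset V, S ⊆ A → S.card = d + 1 → AffineIndependent ℝ (fun i : S => p i.1)

/-- The framework with vertex set `A`, graph `G` (whose edges lie inside `A`) and
configuration `p` is universally rigid. -/
def UniversallyRigidOn {V : Type*} (d : ℕ) (A : Finset V) (G : SimpleGraph V)
    (p : Config V d) : Prop :=
  ∀ d' : ℕ, d ≤ d' → ∀ q : Config V d',
    (∀ i j, G.Adj i j → dist (p i) (p j) = dist (q i) (q j)) →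
    ∀ i ∈ A, ∀ j ∈ A, dist (p i) (p j) = dist (q i) (q j)

/-- The edge-reduced attachment of the graphs `GA` and `GB` sharing the vertices of
`A ∩ B`: from the union `GA ⊔ GB` remove all edges whose endpoints are both shared
vertices and which belong to `GB` but not to `GA`. -/
def edgeReducedAttachment {V : Type*} [DecidableEq V] (A B : Finset V) (GA GB : SimpleGraph V) :
    SimpleGraph V :=
  (GA ⊔ GB).deleteEdges
    {e : Sym2 V | e ∈ GB.edgeSet ∧ e ∉ GA.edgeSet ∧ ∀ v ∈ e, v ∈ A ∩ B}

/-- The distance from a point to an affine combination depends only on the distances. -/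
theorem dist_affine_comb_congr {ι E F : Type*} [Fintype ι]
    [NormedAddCommGroup E] [InnerProductSpace ℝ E] [NormedAddCommGroup F] [InnerProductSpace ℝ F]
    (w : ι → ℝ) (hw : ∑ i, w i = 1) (x : E) (y : ι → E) (x' : F) (y' : ι → F)
    (h1 : ∀ i, dist x (y i) = dist x' (y' i))
    (h2 : ∀ i j, dist (y i) (y j) = dist (y' i) (y' j)) :
    dist x (∑ i, w i • y i) = dist x' (∑ i, w i • y' i) := by
  have key : ∀ {E : Type _} [NormedAddCommGroup E] [InnerProductSpace ℝ E] (x : E) (y : ι → E),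
      x - ∑ i, w i • y i = ∑ i, w i • (x - y i) := by
    intro E _ _ x y
    simp only [smul_sub, Finset.sum_sub_distrib, ← Finset.sum_smul, hw, one_smul]
  have key' : ∀ {E : Type _} [NormedAddCommGroup E] [InnerProductSpace ℝ E] (x : E) (y : ι → E),
      x - ∑ i, w i • y i = ∑ i, w i • (x - y i) := by
    intro E _ _ x y
    simp only [smul_sub, Finset.sum_sub_distrib, ← Finset.sum_smul, hw, one_smul]
  have hin : ∀ i j, inner ℝ (x - y i) (x - y j) = inner ℝ (x' - y' i) (x' - y' j) := by
    intro i j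
    rw [real_inner_eq_norm_mul_self_add_norm_mul_self_sub_norm_sub_mul_self_div_two,
      real_inner_eq_norm_mul_self_add_norm_mul_self_sub_norm_sub_mul_self_div_two,
      sub_sub_sub_cancel_left, sub_sub_sub_cancel_left]
    simp only [← dist_eq_norm, h1, h2]
  have hsq : dist x (∑ i, w i • y i) ^ 2 = dist x' (∑ i, w i • y' i) ^ 2 := by
    rw [dist_eq_norm, dist_eq_norm, key, key', ← real_inner_self_eq_norm_sq,
      ← real_inner_self_eq_norm_sq]
    simp only [sum_inner, inner_sum, inner_smul_left, inner_smul_right, hin]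
  exact (sq_eq_sq₀ dist_nonneg dist_nonneg).1 hsq

/-- The edge-reduced framework attachment of two universally rigid frameworks in
general position in `ℝ^d`, sharing at least `d + 1` vertices, is universally rigid. -/
theorem edgeReducedAttachment_universallyRigid
    {V : Type*} [Fintype V] [DecidableEq V] {d : ℕ}
    (A B : Finset V) (GA GB : SimpleGraph V) (p : Config V d)
    (hGA : ∀ i j, GA.Adj i j → i ∈ A ∧ j ∈ A)
    (hGB : ∀ i j, GB.Adj i j → i ∈ B ∧ j ∈ B)
    (hunion : A ∪ B = Finset.univ)
    (hcard : d + 1 ≤ (A ∩ B).card)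
    (hpropA : A ∩ B ⊂ A) (hpropB : A ∩ B ⊂ B)
    (hgenA : InGeneralPositionOn d A p) (hgenB : InGeneralPositionOn d B p)
    (hurA : UniversallyRigidOn d A GA p) (hurB : UniversallyRigidOn d B GB p) :
    UniversallyRigidOn d Finset.univ (edgeReducedAttachment A B GA GB) p := by
  intro d' hd q hq
  have hA := hurA d' hd q (fun i j hij => hq i j (by
    unfold edgeReducedAttachment
    simp [SimpleGraph.deleteEdges_adj, hij]))
  have hB := hurB d' hd q (fun i j hij => by
    by_cases hC : i ∈ A ∧ j ∈ A
    · exact hA i hC.1 j hC.2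
    · apply hq
      unfold edgeReducedAttachment
      rw [SimpleGraph.deleteEdges_adj]
      refine ⟨Or.inr hij, fun h => hC ?_⟩
      have h3 := h.2.2
      exact ⟨(Finset.mem_inter.1 (h3 i (by simp))).1, (Finset.mem_inter.1 (h3 j (by simp))).1⟩)
  obtain ⟨S, hS, hSc⟩ := Finset.exists_subset_card_eq hcard
  have hSA : ∀ c : S, c.1 ∈ A := fun c => (Finset.mem_inter.1 (hS c.2)).1
  have hSB : ∀ c : S, c.1 ∈ B := fun c => (Finset.mem_inter.1 (hS c.2)).2
  have hind := hgenA S (fun c hc => hSA ⟨c, hc⟩) hSc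
  have htop : affineSpan ℝ (Set.range fun c : S => p c.1) = ⊤ := by
    rw [hind.affineSpan_eq_top_iff_card_eq_finrank_add_one]
    simp [hSc]
  have cross : ∀ i ∈ A, ∀ j ∈ B, dist (p i) (p j) = dist (q i) (q j) := by
    intro i hi j hj
    obtain ⟨w, hw, hpj⟩ := eq_affineCombination_of_mem_affineSpan_of_fintype
      (show p j ∈ affineSpan ℝ (Set.range fun c : S => p c.1) by rw [htop]; trivial)
    rw [Finset.affineCombination_eq_linear_combination _ _ _ hw] at hpj
    have e1 := dist_affine_comb_congr w hw (p j) (fun c : S => p c.1) (q j) (fun c : S => q c.1)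
      (fun c => hB j hj c (hSB c)) (fun c c' => hB c (hSB c) c' (hSB c'))
    have e2 := dist_affine_comb_congr w hw (p i) (fun c : S => p c.1) (q i) (fun c : S => q c.1)
      (fun c => hA i hi c (hSA c)) (fun c c' => hA c (hSA c) c' (hSA c'))
    rw [← hpj] at e1 e2
    rw [dist_self] at e1
    rw [e2, ← dist_eq_zero.1 e1.symm]
  have hAB : ∀ i, i ∈ A ∨ i ∈ B := fun i => by
    rw [← Finset.mem_union, hunion]; exact Finset.mem_univ i
  intro i _ j _
  rcases hAB i with hi | hi <;> rcases hAB j with hj | hj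
  · exact hA i hi j hj
  · exact cross i hi j hj
  · rw [dist_comm (p i), dist_comm (q i)]; exact cross j hj i hi
  · exact hB i hi j hj
end
end
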